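/- Let n ≥ 2 be an integer, let I ⊆ ℝ be a nonempty open interval, and let λ be a real number with 1/n ≤ λ ≤ 2/(2n−1). Then the Hausdorff dimension of S_n(I,λ) equals (2−(n−1)λ)/(1+λ). -/

import Mathlib

open MeasureTheory
open scoped ENNReal

/-- Distance from a real number to the nearest integer. -/
noncomputable def distNearestInt (y : ℝ) : ℝ := |y - round y|

/-- The `n`-th simultaneous Diophantine exponent `λ_n(x) ∈ [0,∞]`: the supremum of all
`λ > 0` such that `max_{1 ≤ i ≤ n} ‖q x^i‖ ≤ q^{-λ}` holds for infinitely many positive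
integers `q`. -/
noncomputable def simExponent (n : ℕ) (x : ℝ) : ℝ≥0∞ :=
  sSup (ENNReal.ofReal '' {l : ℝ | 0 < l ∧
    {q : ℕ | 0 < q ∧
      ∀ i ∈ Finset.Icc 1 n, distNearestInt ((q : ℝ) * x ^ i) ≤ (q : ℝ) ^ (-l)}.Infinite})

/-- `S_n(I, λ) = {x ∈ I : λ_n(x) > λ}`. -/
noncomputable def SimSet (n : ℕ) (I : Set ℝ) (lam : ℝ) : Set ℝ :=
  {x ∈ I | ENNReal.ofReal lam < simExponent n x}


open MeasureTheory
open scoped ENNReal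

open Classical in
/-- weight of cover sets meeting a ball -/
noncomputable def hitSum (U : ℕ → Set ℝ) (w : ℕ → ℝ≥0∞) (z R : ℝ) : ℝ≥0∞ :=
  ∑' i, if (U i ∩ Metric.closedBall z R).Nonempty then w i else 0

open Classical in
theorem mtp_core (B : Set ℝ) (cc rr : ℝ → ℝ) (s s' R z : ℝ) (hs' : 0 < s') (hs1 : s' ≤ 1)
    (hR : 0 < R) (U : ℕ → Set ℝ) (u : ℕ → ℝ) (hu : ∀ i, 0 < u i)
    (hU : ∀ i, ∀ x ∈ U i, ∀ y ∈ U i, dist x y ≤ u i)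
    (hH : hitSum U (fun i => ENNReal.ofReal (u i ^ s')) z R < ENNReal.ofReal (1/100 * R ^ s'))
    (hBc : B.Countable)
    (hBd : B.PairwiseDisjoint fun x => Metric.closedBall (cc x) (rr x ^ s))
    (hr0 : ∀ x ∈ B, 0 < rr x) (hr2 : ∀ x ∈ B, rr x ≤ rr x ^ s / 2)
    (hrK : ∀ x ∈ B, 20 * R ^ (s' - 1) * rr x ^ s ≤ rr x ^ s')
    (hsub : ∀ x ∈ B, Metric.closedBall (cc x) (rr x) ⊆ Metric.closedBall z R)
    (hvol : ENNReal.ofReal (R / 8) ≤ ∑' x : B, ENNReal.ofReal (rr x ^ s)) :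
    ∃ x ∈ B, hitSum U (fun i => ENNReal.ofReal (u i ^ s')) (cc x) (rr x)
        < ENNReal.ofReal (1/100 * rr x ^ s') := by
  by_contra! hfail
  set w : ℕ → ℝ≥0∞ := fun i => ENNReal.ofReal (u i ^ s') with hw
  set A : ℝ≥0∞ := ENNReal.ofReal (5 * R ^ (1 - s')) with hA
  let meets : B → ℕ → Prop := fun b i => (U i ∩ Metric.closedBall (cc b) (rr b)).Nonempty
  let multi : ℕ → Prop := fun i => ∃ b b' : B, b ≠ b' ∧ meets b i ∧ meets b' i
  let g : B → ℕ → ℝ≥0∞ := fun b i =>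
    if meets b i then (if multi i then ENNReal.ofReal (rr b ^ s) else A * w i) else 0
  have hRp : 0 < R ^ (1 - s') := Real.rpow_pos_of_pos hR _
  have h1 : ∀ b : B, ENNReal.ofReal (rr b ^ s) ≤ ∑' i, g b i := by
    intro b
    by_cases hb : ∃ i, meets b i ∧ multi i
    · obtain ⟨i, hi, hm⟩ := hb
      calc ENNReal.ofReal (rr b ^ s) = g b i := by simp [g, hi, hm]
        _ ≤ _ := ENNReal.le_tsum i
    · push Not at hb
      have e : ∑' i, g b i = A * hitSum U w (cc b) (rr b) := by
        rw [hitSum, ← ENNReal.tsum_mul_left]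
        apply tsum_congr
        intro i
        by_cases hi : meets b i
        · have := hb i hi
          have hi' : (U i ∩ Metric.closedBall (cc b) (rr b)).Nonempty := hi
          simp [g, hi, this, hi']
        · have hi' : ¬ (U i ∩ Metric.closedBall (cc b) (rr b)).Nonempty := hi
          simp [g, hi, hi']
      rw [e]
      calc ENNReal.ofReal (rr b ^ s)
          ≤ ENNReal.ofReal (5 * R ^ (1 - s') * (1/100 * rr b ^ s')) := by
            apply ENNReal.ofReal_le_ofReal
            have := hrK b b.2
            have e2 : R ^ (1 - s') * R ^ (s' - 1) = 1 := by
              rw [← Real.rpow_add hR]; simp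
            calc rr b ^ s = 5 * (1/100) * 20 * (R ^ (1 - s') * R ^ (s' - 1)) * rr b ^ s := by
                  rw [e2]; ring
              _ = 5 * R ^ (1 - s') * (1/100 * (20 * R ^ (s' - 1) * rr b ^ s)) := by ring
              _ ≤ _ := by gcongr
        _ = A * ENNReal.ofReal (1/100 * rr b ^ s') := by
            rw [hA, ← ENNReal.ofReal_mul (by positivity)]
        _ ≤ _ := by gcongr; exact hfail b b.2
  have h2 : ∀ i, ∑' b, g b i ≤ A * (if (U i ∩ Metric.closedBall z R).Nonempty then w i else 0) := by
    intro i
    by_cases hi : ∃ b, meets b i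
    swap
    · push Not at hi
      have : ∑' b, g b i = 0 := by simp [g, hi]
      rw [this]; exact zero_le
    obtain ⟨b0, hb0⟩ := hi
    have hJ : (U i ∩ Metric.closedBall z R).Nonempty := by
      obtain ⟨y, hy1, hy2⟩ := hb0
      exact ⟨y, hy1, hsub _ b0.2 hy2⟩
    rw [if_pos hJ]
    by_cases hm : multi i
    swap
    · have : ∑' b, g b i = g b0 i := by
        apply tsum_eq_single
        intro b hb
        by_cases hbi : meets b i
        · exact absurd ⟨b, b0, hb, hbi, hb0⟩ hm
        · simp [g, hbi]
      rw [this]; simp [g, hb0, hm]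
    · -- multi
      have hui : u i ≤ R := by
        have : w i < ENNReal.ofReal (1/100 * R ^ s') := by
          refine lt_of_le_of_lt ?_ hH
          calc w i = if (U i ∩ Metric.closedBall z R).Nonempty then w i else 0 := by rw [if_pos hJ]
            _ ≤ _ := ENNReal.le_tsum (f := fun i => if (U i ∩ Metric.closedBall z R).Nonempty then w i else 0) i
        have h3 : u i ^ s' < 1/100 * R ^ s' := (ENNReal.ofReal_lt_ofReal_iff (by positivity)).1 this
        have h4 : u i ^ s' < R ^ s' := by
          have : 0 < R ^ s' := Real.rpow_pos_of_pos hR _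
          linarith
        exact le_of_lt ((Real.rpow_lt_rpow_iff (hu i).le hR.le hs').1 h4)
      have hρ : ∀ b : B, meets b i → rr b ^ s ≤ 2 * u i := by
        intro b hb
        obtain ⟨b1, b2, h12, hb1, hb2⟩ := hm
        obtain ⟨b', hne, hb'⟩ : ∃ b' : B, b ≠ b' ∧ meets b' i := by
          by_cases h : b = b1
          · exact ⟨b2, by rw [h]; exact h12, hb2⟩
          · exact ⟨b1, h, hb1⟩
        obtain ⟨p, hp1, hp2⟩ := hb
        obtain ⟨p', hp1', hp2'⟩ := hb'
        have hd := hBd b.2 b'.2 (fun h => hne (Subtype.ext h))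
        have hpos := Real.rpow_pos_of_pos (hr0 b b.2) s
        have hpos' := Real.rpow_pos_of_pos (hr0 b' b'.2) s
        have hd2 : rr b ^ s + rr b' ^ s < dist (cc b) (cc b') :=
          (disjoint_closedBall_closedBall_iff hpos.le hpos'.le).1 hd
        have e1 := hU i p hp1 p' hp1'
        have e2 := hr2 b b.2
        have e3 := hr2 b' b'.2
        rw [Metric.mem_closedBall] at hp2 hp2'
        have e4 : dist (cc b) (cc b') ≤ dist p (cc b) + dist p p' + dist p' (cc b') := by
          rw [dist_comm p (cc b)]; exact dist_triangle4 _ _ _ _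
        linarith
      obtain ⟨p0, hp0, hp0'⟩ := hb0
      have key : ∑' b, g b i ≤ ENNReal.ofReal (5 * u i) := by
        let M : Set B := {b | meets b i}
        have e1 : ∑' b, g b i = ∑' b : M, ENNReal.ofReal (rr b ^ s) := by
          rw [tsum_subtype M (fun b : B => ENNReal.ofReal (rr b ^ s))]
          apply tsum_congr
          intro b
          by_cases hb : meets b i
          · have : b ∈ M := hb
            simp [g, hb, hm, this]
          · have : b ∉ M := hb
            simp [g, hb, this]
        have hcM : Countable M := by
          have : Countable B := hBc
          infer_instance
        have e2 : 2 * ∑' b : M, ENNReal.ofReal (rr b ^ s)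
            = volume (⋃ b : M, Metric.closedBall (cc b) (rr b ^ s)) := by
          rw [measure_iUnion]
          · rw [← ENNReal.tsum_mul_left]
            apply tsum_congr
            intro b
            rw [Real.volume_closedBall, ENNReal.ofReal_mul (by norm_num)]
            simp
          · intro b b' hbb
            exact hBd b.1.2 b'.1.2 (fun h => hbb (Subtype.ext (Subtype.ext h)))
          · intro b; exact Metric.isClosed_closedBall.measurableSet
        have e3 : volume (⋃ b : M, Metric.closedBall (cc b) (rr b ^ s))
            ≤ volume (Metric.closedBall p0 (5 * u i)) := by
          apply measure_mono
          apply Set.iUnion_subset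
          intro b y hy
          have hb : meets b i := b.2
          have f1 := hρ b hb
          obtain ⟨p, hp1, hp2⟩ := hb
          rw [Metric.mem_closedBall] at *
          have f2 := hU i p hp1 p0 hp0
          have f3 := hr2 b b.1.2
          have f4 : dist y p0 ≤ dist y (cc b) + dist p (cc b) + dist p p0 := by
            rw [dist_comm p (cc b)]; exact dist_triangle4 _ _ _ _
          linarith [hu i]
        rw [Real.volume_closedBall, ENNReal.ofReal_mul (by norm_num), ← e2] at e3
        simp only [ENNReal.ofReal_ofNat] at e3
        rw [e1]
        exact (ENNReal.mul_le_mul_iff_right (by norm_num) (by norm_num)).1 e3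
      refine key.trans ?_
      rw [hA, hw, ← ENNReal.ofReal_mul (by positivity)]
      apply ENNReal.ofReal_le_ofReal
      calc 5 * u i = 5 * (u i ^ (1 - s') * u i ^ s') := by
            rw [← Real.rpow_add (hu i)]; simp
        _ ≤ 5 * (R ^ (1 - s') * u i ^ s') := by
            have := Real.rpow_le_rpow (hu i).le hui (by linarith : 0 ≤ 1 - s')
            have := Real.rpow_pos_of_pos (hu i) s'
            gcongr
        _ = _ := by ring
  have h3 : ENNReal.ofReal (R / 8) ≤ A * hitSum U w z R := by
    calc _ ≤ ∑' b : B, ENNReal.ofReal (rr b ^ s) := hvol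
      _ ≤ ∑' b, ∑' i, g b i := ENNReal.tsum_le_tsum h1
      _ = ∑' i, ∑' b, g b i := ENNReal.tsum_comm
      _ ≤ ∑' i, A * (if (U i ∩ Metric.closedBall z R).Nonempty then w i else 0) :=
          ENNReal.tsum_le_tsum h2
      _ = _ := by rw [ENNReal.tsum_mul_left]; rfl
  have h4 : A * hitSum U w z R ≤ A * ENNReal.ofReal (1/100 * R ^ s') := by gcongr
  have h5 := h3.trans h4
  rw [hA, ← ENNReal.ofReal_mul (by positivity), ENNReal.ofReal_le_ofReal_iff (by positivity)] at h5
  have e2 : R ^ (1 - s') * R ^ s' = R := by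
    rw [← Real.rpow_add hR]; simp
  have : 5 * R ^ (1 - s') * (1/100 * R ^ s') = R / 20 := by
    linear_combination (1/20) * e2
  rw [this] at h5
  linarith

theorem mtp_step (T : Set ℝ) (s s' R z : ℝ) (hs' : 0 < s') (hss : s' < s) (hs1 : s < 1)
    (hR : 0 < R) (U : ℕ → Set ℝ) (u : ℕ → ℝ) (hu : ∀ i, 0 < u i)
    (hU : ∀ i, ∀ x ∈ U i, ∀ y ∈ U i, dist x y ≤ u i)
    (hH : hitSum U (fun i => ENNReal.ofReal (u i ^ s')) z R < ENNReal.ofReal (1/100 * R ^ s'))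
    (hT : ∀ x ∈ Metric.closedBall z R, Irrational x → ∀ ε > 0, ∃ c r : ℝ, 0 < r ∧ r < ε ∧
      |x - c| ≤ r ^ s ∧ Metric.closedBall c r ⊆ T) :
    ∃ z' R', 0 < R' ∧ R' ≤ R / 2 ∧ Metric.closedBall z' R' ⊆ Metric.closedBall z R ∩ T ∧
      hitSum U (fun i => ENNReal.ofReal (u i ^ s')) z' R' < ENNReal.ofReal (1/100 * R' ^ s') := by
  have hs : 0 < s := hs'.trans hss
  have T1 : Filter.Tendsto (fun r : ℝ => r ^ s) (nhdsWithin 0 (Set.Ioi 0)) (nhds 0) := by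
    have := (Real.continuousAt_rpow_const 0 s (Or.inr hs.le)).tendsto
    rw [Real.zero_rpow hs.ne'] at this
    exact this.mono_left nhdsWithin_le_nhds
  have T2 : Filter.Tendsto (fun r : ℝ => r ^ (1 - s)) (nhdsWithin 0 (Set.Ioi 0)) (nhds 0) := by
    have := (Real.continuousAt_rpow_const 0 (1 - s) (Or.inr (by linarith))).tendsto
    rw [Real.zero_rpow (by linarith)] at this
    exact this.mono_left nhdsWithin_le_nhds
  have T3 : Filter.Tendsto (fun r : ℝ => 20 * R ^ (s' - 1) * r ^ (s - s'))
      (nhdsWithin 0 (Set.Ioi 0)) (nhds 0) := by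
    have := (Real.continuousAt_rpow_const 0 (s - s') (Or.inr (by linarith))).tendsto
    rw [Real.zero_rpow (by linarith)] at this
    simpa using (this.mono_left nhdsWithin_le_nhds).const_mul (20 * R ^ (s' - 1))
  have hev : ∀ᶠ r : ℝ in nhdsWithin 0 (Set.Ioi 0), r ^ s < R / 4 ∧ r ^ (1 - s) < 1 / 2 ∧
      20 * R ^ (s' - 1) * r ^ (s - s') < 1 := by
    filter_upwards [T1.eventually_lt_const (by positivity : (0:ℝ) < R / 4),
      T2.eventually_lt_const (by norm_num : (0:ℝ) < 1/2),
      T3.eventually_lt_const (by norm_num : (0:ℝ) < 1)] with r h1 h2 h3 using ⟨h1, h2, h3⟩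
  obtain ⟨ε, hε, hε'⟩ := mem_nhdsGT_iff_exists_Ioo_subset.1 hev
  have hε : 0 < ε := hε
  set t : Set ℝ := {x | x ∈ Metric.closedBall z (R / 2) ∧ Irrational x} with ht
  have hch : ∀ x : ℝ, ∃ c r : ℝ, x ∈ t → (0 < r ∧ r < ε ∧
      |x - c| ≤ r ^ s ∧ Metric.closedBall c r ⊆ T) := by
    intro x
    by_cases hx : x ∈ t
    · obtain ⟨c, r, h⟩ := hT x (Metric.closedBall_subset_closedBall (by linarith) hx.1) hx.2 ε hε
      exact ⟨c, r, fun _ => h⟩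
    · exact ⟨0, 0, fun h => absurd h hx⟩
  choose cc rr hcr using hch
  have hprop : ∀ x ∈ t, rr x ^ s < R / 4 ∧ rr x ^ (1 - s) < 1 / 2 ∧
      20 * R ^ (s' - 1) * rr x ^ (s - s') < 1 := fun x hx => by
    obtain ⟨h1, h2, -⟩ := hcr x hx
    exact hε' ⟨h1, h2⟩
  obtain ⟨B, hBt, hBd, hBcov⟩ := Vitali.exists_disjoint_subfamily_covering_enlargement_closedBall
    t cc (fun x => rr x ^ s) (R / 4) (fun x hx => (hprop x hx).1.le) 4 (by norm_num)
  have hBc : B.Countable := by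
    apply hBd.countable_of_nonempty_interior
    intro x hx
    have := Real.rpow_pos_of_pos (hcr x (hBt hx)).1 s
    exact ⟨cc x, mem_interior.2 ⟨Metric.ball (cc x) (rr x ^ s), Metric.ball_subset_closedBall,
      Metric.isOpen_ball, Metric.mem_ball_self this⟩⟩
  have hr2 : ∀ x ∈ t, rr x ≤ rr x ^ s / 2 := by
    intro x hx
    have h0 := (hcr x hx).1
    have := Real.rpow_pos_of_pos h0 s
    have e : rr x = rr x ^ s * rr x ^ (1 - s) := by
      rw [← Real.rpow_add h0]; simp
    have := (hprop x hx).2.1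
    calc rr x = rr x ^ s * rr x ^ (1 - s) := e
      _ ≤ rr x ^ s * (1/2) := by gcongr
      _ = _ := by ring
  have hsub : ∀ x ∈ t, Metric.closedBall (cc x) (rr x) ⊆ Metric.closedBall z R := by
    intro x hx y hy
    obtain ⟨h1, h2, h3, h4⟩ := hcr x hx
    have := (hprop x hx).1
    have h5 := hr2 x hx
    have h6 := hx.1
    rw [Metric.mem_closedBall] at *
    rw [← Real.dist_eq] at h3
    have : dist y z ≤ dist y (cc x) + dist x (cc x) + dist x z := by
      rw [dist_comm x (cc x)]; exact dist_triangle4 _ _ _ _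
    linarith
  have hvol : ENNReal.ofReal (R / 8) ≤ ∑' x : B, ENNReal.ofReal (rr x ^ s) := by
    have hcB : Countable B := hBc
    have e0 : volume (Metric.closedBall z (R/2)) ≤ volume t := by
      have hq : volume (Set.range ((↑) : ℚ → ℝ)) = 0 :=
        (Set.countable_range _).measure_zero _
      calc volume (Metric.closedBall z (R/2)) ≤ volume (t ∪ Set.range ((↑) : ℚ → ℝ)) := by
            apply measure_mono
            intro x hx
            by_cases h : Irrational x
            · exact Or.inl ⟨hx, h⟩
            · right; simpa [Irrational] using h
        _ ≤ volume t + volume (Set.range ((↑) : ℚ → ℝ)) := measure_union_le _ _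
        _ = _ := by rw [hq, add_zero]
    have e1 : t ⊆ ⋃ b : B, Metric.closedBall (cc b) (4 * rr b ^ s) := by
      intro x hx
      obtain ⟨b, hb, hb2⟩ := hBcov x hx
      refine Set.mem_iUnion.2 ⟨⟨b, hb⟩, hb2 ?_⟩
      rw [Metric.mem_closedBall, Real.dist_eq]
      exact (hcr x hx).2.2.1
    have e2 : volume t ≤ 8 * ∑' x : B, ENNReal.ofReal (rr x ^ s) := by
      calc volume t ≤ _ := measure_mono e1
        _ ≤ ∑' b : B, volume (Metric.closedBall (cc b) (4 * rr b ^ s)) := measure_iUnion_le _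
        _ = ∑' b : B, 8 * ENNReal.ofReal (rr b ^ s) := by
            apply tsum_congr
            intro b
            rw [Real.volume_closedBall, ← mul_assoc, ENNReal.ofReal_mul (by norm_num)]
            norm_num
        _ = _ := by rw [ENNReal.tsum_mul_left]
    rw [Real.volume_closedBall] at e0
    have e3 := e0.trans e2
    have e4 : ENNReal.ofReal (2 * (R / 2)) = 8 * ENNReal.ofReal (R / 8) := by
      rw [show 2 * (R / 2) = 8 * (R / 8) by ring, ENNReal.ofReal_mul (by norm_num)]; norm_num
    rw [e4] at e3
    exact (ENNReal.mul_le_mul_iff_right (by norm_num) (by norm_num)).1 e3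
  obtain ⟨x, hxB, hx⟩ := mtp_core B cc rr s s' R z hs' (by linarith) hR U u hu hU hH hBc hBd
    (fun x hx => (hcr x (hBt hx)).1) (fun x hx => hr2 x (hBt hx)) (by
      intro x hx
      have h0 := (hcr x (hBt hx)).1
      have h3 := (hprop x (hBt hx)).2.2
      have e : rr x ^ s = rr x ^ (s - s') * rr x ^ s' := by
        rw [← Real.rpow_add h0]; simp
      have := Real.rpow_pos_of_pos h0 s'
      rw [e, ← mul_assoc]
      nlinarith) (fun x hx => hsub x (hBt hx)) hvol
  have hxt := hBt hxB
  refine ⟨cc x, rr x, (hcr x hxt).1, ?_, Set.subset_inter (hsub x hxt) (hcr x hxt).2.2.2, hx⟩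
  have := hr2 x hxt
  have := (hprop x hxt).1
  linarith

theorem mtp_point (a b : ℝ) (hab : a < b) (T : ℕ → Set ℝ) (s s' : ℝ) (hs' : 0 < s') (hss : s' < s)
    (hs1 : s < 1)
    (hT : ∀ G, ∀ x ∈ Set.Ioo a b, Irrational x → ∀ ε > 0, ∃ c r : ℝ, 0 < r ∧ r < ε ∧
      |x - c| ≤ r ^ s ∧ Metric.closedBall c r ⊆ T G) :
    ∃ ε : ℝ, 0 < ε ∧ ∀ (U : ℕ → Set ℝ) (u : ℕ → ℝ), (∀ i, 0 < u i) →
      (∀ i, ∀ x ∈ U i, ∀ y ∈ U i, dist x y ≤ u i) →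
      (∑' i, ENNReal.ofReal (u i ^ s') < ENNReal.ofReal ε) →
      ∃ x ∈ Set.Ioo a b, (∀ G, x ∈ T G) ∧ ∀ i, x ∉ U i := by
  set z := (a + b) / 2 with hz
  set R := (b - a) / 4 with hRd
  have hR : 0 < R := by rw [hRd]; linarith
  have hzR : Metric.closedBall z R ⊆ Set.Ioo a b := by
    intro x hx
    rw [Metric.mem_closedBall, Real.dist_eq, abs_le] at hx
    constructor <;> linarith [hx.1, hx.2]
  refine ⟨1/100 * R ^ s', by positivity, ?_⟩
  intro U u hu hU hsum
  let P : ℝ × ℝ → Prop := fun p => 0 < p.2 ∧ Metric.closedBall p.1 p.2 ⊆ Metric.closedBall z R ∧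
    hitSum U (fun i => ENNReal.ofReal (u i ^ s')) p.1 p.2 < ENNReal.ofReal (1/100 * p.2 ^ s')
  have hstep : ∀ (G : ℕ) (p : {p // P p}), ∃ p' : {p // P p}, p'.1.2 ≤ p.1.2 / 2 ∧
      Metric.closedBall p'.1.1 p'.1.2 ⊆ Metric.closedBall p.1.1 p.1.2 ∩ T G := by
    rintro G ⟨p, hp0, hp1, hp2⟩
    obtain ⟨z', R', h1, h2, h3, h4⟩ := mtp_step (T G) s s' p.2 p.1 hs' hss hs1 hp0 U u hu hU hp2
      (fun x hx => hT G x (hzR (hp1 hx)))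
    exact ⟨⟨(z', R'), h1, (h3.trans Set.inter_subset_left).trans hp1, h4⟩, h2, h3⟩
  choose nxt hn1 hn2 using hstep
  have hP0 : P (z, R) := by
    refine ⟨hR, subset_rfl, lt_of_le_of_lt ?_ hsum⟩
    apply ENNReal.tsum_le_tsum
    intro i
    split_ifs
    · exact le_rfl
    · exact zero_le
  let seq : ℕ → {p // P p} := fun k => Nat.rec ⟨(z, R), hP0⟩ (fun k p => nxt k p) k
  have hseq : ∀ k, seq (k+1) = nxt k (seq k) := fun k => rfl
  have hne : (⋂ k, Metric.closedBall (seq k).1.1 (seq k).1.2).Nonempty := by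
    apply IsCompact.nonempty_iInter_of_sequence_nonempty_isCompact_isClosed
    · intro k
      rw [hseq]
      exact (hn2 k (seq k)).trans Set.inter_subset_left
    · intro k
      exact Metric.nonempty_closedBall.2 (seq k).2.1.le
    · exact isCompact_closedBall _ _
    · intro k; exact Metric.isClosed_closedBall
  obtain ⟨x, hx⟩ := hne
  rw [Set.mem_iInter] at hx
  refine ⟨x, hzR (hx 0), fun G => ?_, fun i hi => ?_⟩
  · have := hx (G+1)
    rw [hseq] at this
    exact (hn2 G (seq G) this).2
  · have hsm : ∀ k, (seq k).1.2 ≤ R * (1/2)^k := by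
      intro k
      induction k with
      | zero => simp [seq]
      | succ k ih =>
        have := hn1 k (seq k)
        rw [← hseq] at this
        rw [pow_succ]; linarith
    have hlt : ∀ k, u i < R * (1/2)^k := by
      intro k
      refine lt_of_lt_of_le ?_ (hsm k)
      obtain ⟨q0, q1, q2⟩ := (seq k).2
      have hmeet : (U i ∩ Metric.closedBall (seq k).1.1 (seq k).1.2).Nonempty := ⟨x, hi, hx k⟩
      have h1 : ENNReal.ofReal (u i ^ s') < ENNReal.ofReal (1/100 * (seq k).1.2 ^ s') := by
        refine lt_of_le_of_lt ?_ q2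
        classical
        calc ENNReal.ofReal (u i ^ s') = if (U i ∩ Metric.closedBall (seq k).1.1 (seq k).1.2).Nonempty
              then ENNReal.ofReal (u i ^ s') else 0 := by rw [if_pos hmeet]
          _ ≤ _ := by
            unfold hitSum
            convert ENNReal.le_tsum (f := fun i => if (U i ∩ Metric.closedBall (seq k).1.1 (seq k).1.2).Nonempty
              then ENNReal.ofReal (u i ^ s') else 0) i
      have hp : 0 < (seq k).1.2 ^ s' := Real.rpow_pos_of_pos q0 _
      have h3 := (ENNReal.ofReal_lt_ofReal_iff (by positivity)).1 h1
      have h4 : u i ^ s' < (seq k).1.2 ^ s' := by linarith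
      exact (Real.rpow_lt_rpow_iff (hu i).le q0.le hs').1 h4
    have hlim : Filter.Tendsto (fun k : ℕ => R * (1/2:ℝ)^k) Filter.atTop (nhds 0) := by
      simpa using (tendsto_pow_atTop_nhds_zero_of_lt_one (by norm_num : (0:ℝ) ≤ 1/2)
        (by norm_num)).const_mul R
    obtain ⟨k, hk⟩ := (hlim.eventually_lt_const (hu i)).exists
    exact absurd (hlt k) (not_lt.2 hk.le)

theorem mtp_dim (a b : ℝ) (hab : a < b) (T : ℕ → Set ℝ) (s s' : ℝ) (hs' : 0 < s') (hss : s' < s)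
    (hs1 : s < 1)
    (hT : ∀ G, ∀ x ∈ Set.Ioo a b, Irrational x → ∀ ε > 0, ∃ c r : ℝ, 0 < r ∧ r < ε ∧
      |x - c| ≤ r ^ s ∧ Metric.closedBall c r ⊆ T G) :
    ENNReal.ofReal s' ≤ dimH (Set.Ioo a b ∩ ⋂ G, T G) := by
  obtain ⟨ε, hε, H⟩ := mtp_point a b hab T s s' hs' hss hs1 hT
  apply le_dimH_of_hausdorffMeasure_ne_zero
  rw [Real.coe_toNNReal s' hs'.le]
  intro h0
  rw [Measure.hausdorffMeasure_apply] at h0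
  simp only [ENNReal.iSup_eq_zero] at h0
  have h1 := h0 1 (by norm_num)
  have hε2 : (0:ℝ≥0∞) < ENNReal.ofReal (ε / 4) := by simpa using by positivity
  rw [← h1] at hε2
  simp only [iInf_lt_iff] at hε2
  obtain ⟨U, hcov, hdiam, hsum⟩ := hε2
  obtain ⟨η, hη0, hη⟩ := ENNReal.exists_pos_sum_of_countable
    (show ENNReal.ofReal (ε/4) ≠ 0 by simpa using by positivity) ℕ
  set u : ℕ → ℝ := fun i => (Metric.ediam (U i)).toReal + (η i : ℝ) ^ (1 / s') with hu
  have hfin : ∀ i, Metric.ediam (U i) ≠ ⊤ := fun i => ne_top_of_le_ne_top (by norm_num) (hdiam i)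
  have hu0 : ∀ i, 0 < u i := fun i => by
    have : 0 < (η i : ℝ) ^ (1 / s') := Real.rpow_pos_of_pos (by exact_mod_cast hη0 i) _
    have := ENNReal.toReal_nonneg (a := Metric.ediam (U i))
    simp only [hu]; linarith
  have hUd : ∀ i, ∀ x ∈ U i, ∀ y ∈ U i, dist x y ≤ u i := by
    intro i x hx y hy
    have h : edist x y ≤ Metric.ediam (U i) := Metric.edist_le_ediam_of_mem hx hy
    have h2 : dist x y ≤ (Metric.ediam (U i)).toReal := by
      rw [dist_edist]; exact ENNReal.toReal_mono (hfin i) h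
    have : 0 ≤ (η i : ℝ) ^ (1 / s') := by positivity
    simp only [hu]; linarith
  obtain ⟨x, hx, hxT, hxU⟩ := H U u hu0 hUd (by
    calc ∑' i, ENNReal.ofReal (u i ^ s')
        ≤ ∑' i, ((⨆ (_ : (U i).Nonempty), Metric.ediam (U i) ^ s') + (η i : ℝ≥0∞)) := by
          apply ENNReal.tsum_le_tsum
          intro i
          have e1 : u i ^ s' ≤ (Metric.ediam (U i)).toReal ^ s' + η i := by
            have := Real.rpow_add_le_add_rpow (ENNReal.toReal_nonneg (a := Metric.ediam (U i)))
              (show (0:ℝ) ≤ (η i : ℝ) ^ (1 / s') by positivity) hs'.le (by linarith : s' ≤ 1)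
            rwa [← Real.rpow_mul (by positivity), one_div_mul_cancel hs'.ne', Real.rpow_one] at this
          calc ENNReal.ofReal (u i ^ s') ≤ ENNReal.ofReal ((Metric.ediam (U i)).toReal ^ s' + η i) :=
                ENNReal.ofReal_le_ofReal e1
            _ = Metric.ediam (U i) ^ s' + η i := by
                rw [ENNReal.ofReal_add (by positivity) (by positivity),
                  ← ENNReal.ofReal_rpow_of_nonneg ENNReal.toReal_nonneg hs'.le,
                  ENNReal.ofReal_toReal (hfin i), ENNReal.ofReal_coe_nnreal]
            _ ≤ _ := by
                gcongr
                rcases (U i).eq_empty_or_nonempty with h | h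
                · simp [h, hs']
                · simp [h]
      _ = _ := ENNReal.tsum_add
      _ < ENNReal.ofReal (ε/4) + ENNReal.ofReal (ε/4) := ENNReal.add_lt_add hsum hη
      _ ≤ ENNReal.ofReal ε := by
          rw [← ENNReal.ofReal_add (by positivity) (by positivity)]
          apply ENNReal.ofReal_le_ofReal; linarith)
  have : x ∈ ⋃ n, U n := hcov ⟨hx, Set.mem_iInter.2 hxT⟩
  obtain ⟨i, hi⟩ := Set.mem_iUnion.1 this
  exact hxU i hi

open MeasureTheory
open scoped ENNReal

theorem fract_close {K : ℕ} (hK : 0 < K) (u v : ℝ)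
    (h : ⌊(K:ℝ) * Int.fract u⌋₊ = ⌊(K:ℝ) * Int.fract v⌋₊) :
    |Int.fract u - Int.fract v| ≤ 1 / (K:ℝ) := by
  have hK' : (0:ℝ) < K := by exact_mod_cast hK
  have hu := Int.fract_nonneg u
  have hv := Int.fract_nonneg v
  have h1 := Nat.floor_le (by positivity : 0 ≤ (K:ℝ) * Int.fract u)
  have h2 := Nat.lt_floor_add_one ((K:ℝ) * Int.fract u)
  have h3 := Nat.floor_le (by positivity : 0 ≤ (K:ℝ) * Int.fract v)
  have h4 := Nat.lt_floor_add_one ((K:ℝ) * Int.fract v)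
  rw [h] at h1 h2
  rw [abs_le, ← neg_div, div_le_iff₀ hK', le_div_iff₀ hK']
  constructor <;> nlinarith

theorem fract_box {K : ℕ} (hK : 0 < K) (u : ℝ) : ⌊(K:ℝ) * Int.fract u⌋₊ ∈ Finset.range K := by
  have hK' : (0:ℝ) < K := by exact_mod_cast hK
  rw [Finset.mem_range, Nat.floor_lt (by have := Int.fract_nonneg u; positivity)]
  have := Int.fract_lt_one u
  nlinarith

theorem dirichlet_tangent (m : ℕ) (x lam Q : ℝ) (hQ : 1 ≤ Q) (hl : 0 < lam)
    (hw : 0 < 1 - m * lam) :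
    ∃ q : ℕ, 1 ≤ q ∧ (q:ℝ) ≤ 2 ^ (m+1) * Q ∧ ∃ p1 : ℤ, |q * x - p1| ≤ Q ^ (-(1 - m * lam)) ∧
      ∀ i < m, ∃ p : ℤ, |(i + 2) * x ^ (i+1) * p1 - (i + 1) * x ^ (i+2) * q - p| ≤ Q ^ (-lam) := by
  have hQ0 : 0 < Q := by linarith
  set K1 := ⌈Q ^ (1 - m * lam)⌉₊ with hK1
  set K := ⌈Q ^ lam⌉₊ with hK
  have hp1 : 0 < Q ^ (1 - m * lam) := Real.rpow_pos_of_pos hQ0 _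
  have hp2 : 0 < Q ^ lam := Real.rpow_pos_of_pos hQ0 _
  have hK1p : 0 < K1 := Nat.ceil_pos.2 hp1
  have hKp : 0 < K := Nat.ceil_pos.2 hp2
  have ho1 : 1 ≤ Q ^ (1 - m * lam) := Real.one_le_rpow hQ hw.le
  have ho2 : 1 ≤ Q ^ lam := Real.one_le_rpow hQ hl.le
  have hK1le : (K1:ℝ) ≤ 2 * Q ^ (1 - m * lam) := by
    have := Nat.ceil_lt_add_one hp1.le; rw [← hK1] at this; linarith
  have hKle : (K:ℝ) ≤ 2 * Q ^ lam := by
    have := Nat.ceil_lt_add_one hp2.le; rw [← hK] at this; linarith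
  set N := K1 * K ^ m with hN
  let v : Fin m → ℕ → ℝ := fun i q =>
    ((i:ℕ) + 2) * x ^ ((i:ℕ)+1) * (⌊(q:ℝ) * x⌋ : ℝ) - ((i:ℕ) + 1) * x ^ ((i:ℕ)+2) * q
  let F : ℕ → ℕ × (Fin m → ℕ) := fun q =>
    (⌊(K1:ℝ) * Int.fract ((q:ℝ) * x)⌋₊, fun i => ⌊(K:ℝ) * Int.fract (v i q)⌋₊)
  have hcard : (Finset.range K1 ×ˢ Fintype.piFinset (fun _ : Fin m => Finset.range K)).card
      < (Finset.range (N+1)).card := by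
    simp [Finset.card_product, Fintype.card_piFinset, hN]
  obtain ⟨q, hq, q', hq', hne, hF⟩ := Finset.exists_ne_map_eq_of_card_lt_of_maps_to hcard
    (f := F) (by
      intro q _
      simp only [F, Finset.coe_product, Set.mem_prod]
      refine ⟨by exact_mod_cast fract_box hK1p _, ?_⟩
      rw [Finset.mem_coe, Fintype.mem_piFinset]
      intro i; exact fract_box hKp _)
  wlog hlt : q < q' generalizing q q'
  · exact this q' hq' q hq hne.symm hF.symm (lt_of_le_of_ne (not_lt.1 hlt) hne.symm)
  have hF1 : ⌊(K1:ℝ) * Int.fract ((q:ℝ) * x)⌋₊ = ⌊(K1:ℝ) * Int.fract ((q':ℝ) * x)⌋₊ :=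
    congrArg Prod.fst hF
  have hF2 : ∀ i : Fin m, ⌊(K:ℝ) * Int.fract (v i q)⌋₊ = ⌊(K:ℝ) * Int.fract (v i q')⌋₊ := fun i =>
    congrFun (congrArg Prod.snd hF) i
  have hcast : ((q' - q : ℕ) : ℝ) = q' - q := by push_cast [hlt.le]; ring
  refine ⟨q' - q, by omega, ?_, ⌊(q':ℝ) * x⌋ - ⌊(q:ℝ) * x⌋, ?_, ?_⟩
  · have h1 : ((q' - q : ℕ) : ℝ) ≤ N := by
      have : q' - q ≤ N := by have := Finset.mem_range.1 hq'; omega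
      exact_mod_cast this
    refine h1.trans ?_
    have e : Q ^ (1 - m * lam) * (Q ^ lam) ^ m = Q := by
      rw [← Real.rpow_natCast, ← Real.rpow_mul hQ0.le, ← Real.rpow_add hQ0,
        show 1 - m * lam + lam * m = 1 by ring, Real.rpow_one]
    calc (N:ℝ) = K1 * (K:ℝ) ^ m := by rw [hN]; push_cast; ring
      _ ≤ (2 * Q ^ (1 - m * lam)) * (2 * Q ^ lam) ^ m := by gcongr
      _ = 2 ^ (m+1) * (Q ^ (1 - m * lam) * (Q ^ lam) ^ m) := by rw [mul_pow]; ring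
      _ = _ := by rw [e]
  · have := fract_close hK1p _ _ hF1
    rw [hcast]; push_cast
    have e : (q' - q : ℝ) * x - ((⌊(q':ℝ) * x⌋ : ℝ) - ⌊(q:ℝ) * x⌋)
        = -(Int.fract ((q:ℝ) * x) - Int.fract ((q':ℝ) * x)) := by
      rw [Int.fract, Int.fract]; ring
    rw [e, abs_neg, Real.rpow_neg hQ0.le]
    refine this.trans ?_
    rw [one_div]
    exact inv_anti₀ hp1 (Nat.le_ceil _)
  · intro i hi
    have := fract_close hKp _ _ (hF2 ⟨i, hi⟩)
    refine ⟨⌊v ⟨i, hi⟩ q'⌋ - ⌊v ⟨i, hi⟩ q⌋, ?_⟩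
    rw [hcast]; push_cast
    have e : (i + 2 : ℝ) * x ^ (i+1) * ((⌊(q':ℝ) * x⌋ : ℝ) - ⌊(q:ℝ) * x⌋)
        - (i+1) * x ^ (i+2) * (q' - q) - ((⌊v ⟨i, hi⟩ q'⌋ : ℝ) - ⌊v ⟨i, hi⟩ q⌋)
        = -(Int.fract (v ⟨i, hi⟩ q) - Int.fract (v ⟨i, hi⟩ q')) := by
      rw [Int.fract, Int.fract]; simp only [v]; ring
    rw [e, abs_neg, Real.rpow_neg hQ0.le]
    refine this.trans ?_
    rw [one_div]
    exact inv_anti₀ hp2 (Nat.le_ceil _)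

theorem taylor2 (K : ℝ) (hK : 0 ≤ K) (i : ℕ) : ∃ C : ℝ, 0 ≤ C ∧ ∀ c x : ℝ, |c| ≤ K → |x| ≤ K →
    |c ^ (i+1) - x ^ (i+1) - (i+1) * x ^ i * (c - x)| ≤ C * |c - x| ^ 2 := by
  induction i with
  | zero => exact ⟨0, le_rfl, fun c x _ _ => by simp⟩
  | succ i ih =>
    obtain ⟨C, hC, h⟩ := ih
    refine ⟨K * C + (i+1) * K ^ i, by positivity, fun c x hc hx => ?_⟩
    have e : c ^ (i+1+1) - x ^ (i+1+1) - ((i+1:ℕ)+1) * x ^ (i+1) * (c - x)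
        = c * (c ^ (i+1) - x ^ (i+1) - (i+1) * x ^ i * (c - x)) + (i+1) * x ^ i * (c-x)^2 := by
      push_cast; ring
    rw [e]
    refine (abs_add_le _ _).trans ?_
    rw [abs_mul, abs_mul, abs_mul, abs_pow, abs_pow, add_mul (K * C)]
    have h1 := h c x hc hx
    have h2 : |((i:ℝ)+1)| = i + 1 := abs_of_pos (by positivity)
    rw [h2, mul_assoc K]
    gcongr

theorem pow_lip (K : ℝ) (hK : 0 ≤ K) (i : ℕ) : ∃ C : ℝ, 0 ≤ C ∧ ∀ c x : ℝ, |c| ≤ K → |x| ≤ K →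
    |c ^ i - x ^ i| ≤ C * |c - x| := by
  induction i with
  | zero => exact ⟨0, le_rfl, fun c x _ _ => by simp⟩
  | succ i ih =>
    obtain ⟨C, hC, h⟩ := ih
    refine ⟨K * C + K ^ i, by positivity, fun c x hc hx => ?_⟩
    have e : c ^ (i+1) - x ^ (i+1) = c * (c ^ i - x ^ i) + x ^ i * (c-x) := by ring
    rw [e]
    refine (abs_add_le _ _).trans ?_
    rw [abs_mul, abs_mul, abs_pow, add_mul, mul_assoc K]
    have h1 := h c x hc hx
    gcongr

/-- small denominators are avoided for irrational `x` -/
theorem irr_far (x : ℝ) (hx : Irrational x) (q0 : ℕ) : ∃ δ > 0, ∀ q : ℕ, 1 ≤ q → q ≤ q0 →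
    ∀ p : ℤ, δ ≤ |q * x - p| := by
  induction q0 with
  | zero => exact ⟨1, one_pos, fun q h1 h2 => by omega⟩
  | succ k ih =>
    obtain ⟨δ, hδ, h⟩ := ih
    have hpos : 0 < |((k+1:ℕ):ℝ) * x - round (((k+1:ℕ):ℝ) * x)| := by
      rw [abs_pos, sub_ne_zero]
      have : Irrational (((k+1:ℕ):ℝ) * x) := hx.natCast_mul (by omega)
      exact this.ne_int _
    refine ⟨min δ _, lt_min hδ hpos, fun q h1 h2 p => ?_⟩
    rcases Nat.lt_or_ge k q with hk | hk
    · have : q = k + 1 := by omega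
      subst this
      exact (min_le_right _ _).trans (round_le _ _)
    · exact (min_le_left _ _).trans (h q h1 hk p)

theorem ev_rpow (C u v : ℝ) (huv : u < v) : ∀ᶠ q : ℕ in Filter.atTop,
    C * (q:ℝ) ^ u ≤ (q:ℝ) ^ v := by
  have h := (tendsto_rpow_atTop (sub_pos.2 huv)).comp (tendsto_natCast_atTop_atTop (R := ℝ))
  filter_upwards [h.eventually_ge_atTop C, Filter.eventually_gt_atTop 0] with q h1 h2
  have hq : (0:ℝ) < q := by exact_mod_cast h2
  have e : (q:ℝ) ^ v = (q:ℝ) ^ (v - u) * (q:ℝ) ^ u := by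
    rw [← Real.rpow_add hq]; simp
  rw [e]
  have := Real.rpow_pos_of_pos hq u
  simp only [Function.comp] at h1
  gcongr

theorem lower_balls (m : ℕ) (x lam l s : ℝ) (hx : Irrational x) (hl : 0 < lam) (hl1 : lam ≤ 1)
    (hw : 0 < 1 - m * lam) (hll : l < lam) (hs : s * (1 + lam) < 2 - m * lam) (G : ℕ)
    (ε : ℝ) (hε : 0 < ε) :
    ∃ c r : ℝ, 0 < r ∧ r < ε ∧ |x - c| ≤ r ^ s ∧ Metric.closedBall c r ⊆
      {y | ∃ q : ℕ, G ≤ q ∧ 0 < q ∧ ∀ i ∈ Finset.Icc 1 (m+1),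
        distNearestInt ((q:ℝ) * y ^ i) ≤ (q:ℝ) ^ (-l)} := by
  set K := |x| + 2 with hK
  have hK0 : 0 ≤ K := by positivity
  choose C1 hC1 hT2 using taylor2 K hK0
  choose C2 hC2 hLip using pow_lip K hK0
  set w := 1 - m * lam with hwd
  set D : ℝ := (2 ^ (m+1)) ^ lam with hD
  have hev : ∀ᶠ q : ℕ in Filter.atTop, G ≤ q ∧ 0 < q ∧ (q:ℝ) ^ (-1 - lam) < ε ∧
      (2 ^ (m+1)) ^ w * (q:ℝ) ^ (-1 - w) ≤ ((q:ℝ) ^ (-1 - lam)) ^ s ∧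
      1 * (q:ℝ) ^ (-lam) ≤ (q:ℝ) ^ (-l) ∧
      ∀ i ∈ Finset.range m, (C2 (i+2) + C1 (i+1) + D) * (q:ℝ) ^ (-lam) ≤ (q:ℝ) ^ (-l) := by
    have t1 : Filter.Tendsto (fun q : ℕ => (q:ℝ) ^ (-1 - lam)) Filter.atTop (nhds 0) := by
      have := (tendsto_rpow_neg_atTop (by linarith : 0 < 1 + lam)).comp
        (tendsto_natCast_atTop_atTop (R := ℝ))
      refine this.congr fun q => ?_
      simp only [Function.comp]; congr 1; ring
    have t2 := ev_rpow ((2 ^ (m+1)) ^ w) (-1 - w) ((-1 - lam) * s) (by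
      rw [hwd]; linarith)
    have t4 : ∀ᶠ q : ℕ in Filter.atTop, ∀ i ∈ Finset.range m,
        (C2 (i+2) + C1 (i+1) + D) * (q:ℝ) ^ (-lam) ≤ (q:ℝ) ^ (-l) := by
      rw [Filter.eventually_all_finset]
      intro i _
      exact ev_rpow _ _ _ (by linarith)
    filter_upwards [Filter.eventually_ge_atTop G, Filter.eventually_gt_atTop 0,
      t1.eventually_lt_const hε, t2, ev_rpow 1 (-lam) (-l) (by linarith), t4]
      with q h1 h2 h3 h4 h5 h6
    refine ⟨h1, h2, h3, ?_, h5, h6⟩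
    rw [← Real.rpow_mul (by positivity)]; exact h4
  obtain ⟨q0, hq0⟩ := Filter.eventually_atTop.1 hev
  obtain ⟨δ, hδ, hfar⟩ := irr_far x hx q0
  obtain ⟨Q, hQ1, hQ2⟩ : ∃ Q : ℝ, 1 ≤ Q ∧ Q ^ (-w) < δ :=
    ((Filter.eventually_ge_atTop 1).and
      ((tendsto_rpow_neg_atTop hw).eventually_lt_const hδ)).exists
  have hQ0 : 0 < Q := by linarith
  obtain ⟨q, hq1, hqQ, p1, hp1, hp⟩ := dirichlet_tangent m x lam Q hQ1 hl hw
  have hqq : q0 ≤ q := by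
    by_contra hlt
    have := hfar q hq1 (by omega) p1
    linarith
  obtain ⟨g1, g2, g3, g4, g5, g6⟩ := hq0 q hqq
  have hq0' : (0:ℝ) < q := by exact_mod_cast g2
  have hq1' : (1:ℝ) ≤ q := by exact_mod_cast hq1
  set c : ℝ := p1 / q with hc
  set r : ℝ := (q:ℝ) ^ (-1 - lam) with hr
  have hQq : ∀ t : ℝ, 0 ≤ t → Q ^ (-t) ≤ (2 ^ (m+1)) ^ t * (q:ℝ) ^ (-t) := by
    intro t ht
    have h2 : (q:ℝ) / 2 ^ (m+1) ≤ Q := by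
      rw [div_le_iff₀ (by positivity)]; linarith
    calc Q ^ (-t) ≤ ((q:ℝ) / 2 ^ (m+1)) ^ (-t) :=
          Real.rpow_le_rpow_of_nonpos (by positivity) h2 (by linarith)
      _ = _ := by
          rw [Real.div_rpow (by positivity) (by positivity), Real.rpow_neg (by positivity : (0:ℝ) ≤ 2^(m+1)),
            div_inv_eq_mul, mul_comm]
  have hqc : (q:ℝ) * c = p1 := by rw [hc]; field_simp
  have hxc : |x - c| = |q * x - p1| / q := by
    rw [eq_div_iff hq0'.ne', ← abs_of_pos hq0', ← abs_mul, abs_of_pos hq0']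
    congr 1; rw [sub_mul, mul_comm c, hqc]; ring
  have hQle1 : |q * x - p1| ≤ 1 := hp1.trans
    (Real.rpow_le_one_of_one_le_of_nonpos hQ1 (by linarith))
  have hxc1 : |x - c| ≤ 1 := by
    rw [hxc, div_le_one hq0']; linarith
  have hr1 : r ≤ 1 := Real.rpow_le_one_of_one_le_of_nonpos hq1' (by linarith)
  have hr0 : 0 < r := Real.rpow_pos_of_pos hq0' _
  have hqr : (q:ℝ) * r = (q:ℝ) ^ (-lam) := by
    rw [hr]; nth_rewrite 1 [← Real.rpow_one (q:ℝ)]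
    rw [← Real.rpow_add hq0']; congr 1; ring
  have hxK : |x| ≤ K := by rw [hK]; linarith
  have hcK : |c| ≤ K := by
    have : |c| ≤ |x| + |x - c| := by
      have := abs_sub x (x - c); simpa using this
    rw [hK]; linarith
  refine ⟨c, r, hr0, g3, ?_, ?_⟩
  · refine le_trans ?_ g4
    rw [hxc, div_le_iff₀ hq0']
    refine hp1.trans ((hQq w hw.le).trans (le_of_eq ?_))
    rw [mul_assoc]; congr 1
    nth_rewrite 3 [← Real.rpow_one (q:ℝ)]
    rw [← Real.rpow_add hq0']; congr 1; ring
  · intro y hy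
    rw [Metric.mem_closedBall, Real.dist_eq] at hy
    have hyK : |y| ≤ K := by
      have h1 : |y| ≤ |y - c| + |c| := by
        have := abs_add_le (y - c) c; simpa using this
      have h2 : |c| ≤ |x| + |x - c| := by
        have := abs_sub x (x - c); simpa using this
      rw [hK]; linarith
    refine ⟨q, g1, g2, ?_⟩
    intro i hi
    rw [Finset.mem_Icc] at hi
    unfold distNearestInt
    rcases Nat.lt_or_ge i 2 with h2 | h2
    · have : i = 1 := by omega
      subst this
      refine (round_le _ p1).trans (le_trans ?_ g5)
      rw [pow_one, ← hqc, ← mul_sub, abs_mul, abs_of_pos hq0', one_mul, ← hqr]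
      gcongr
    · obtain ⟨j, rfl⟩ : ∃ j, i = j + 2 := ⟨i - 2, by omega⟩
      have hj : j < m := by omega
      obtain ⟨p, hp⟩ := hp j hj
      refine (round_le _ p).trans (le_trans ?_ (g6 j (Finset.mem_range.2 hj)))
      have e : (q:ℝ) * y ^ (j+2) - p = q * (y ^ (j+2) - c ^ (j+2))
          + q * (c ^ (j+1+1) - x ^ (j+1+1) - ((j+1:ℕ)+1) * x ^ (j+1) * (c - x))
          + ((j + 2) * x ^ (j+1) * p1 - (j + 1) * x ^ (j+2) * q - p) := by
        rw [← hqc]; push_cast; ring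
      rw [e]
      refine (abs_add_le _ _).trans ?_
      rw [add_mul (C2 (j+2) + C1 (j+1))]
      apply add_le_add
      · refine (abs_add_le _ _).trans ?_
        rw [add_mul (C2 (j+2))]
        apply add_le_add
        · rw [abs_mul, abs_of_pos hq0', ← hqr]
          calc (q:ℝ) * |y ^ (j+2) - c ^ (j+2)| ≤ q * (C2 (j+2) * |y - c|) := by
                gcongr; exact hLip _ _ _ hyK hcK
            _ ≤ q * (C2 (j+2) * r) := by have := hC2 (j+2); gcongr
            _ = _ := by ring
        · rw [abs_mul, abs_of_pos hq0']
          calc (q:ℝ) * _ ≤ q * (C1 (j+1) * |c - x| ^ 2) := by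
                gcongr; exact hT2 _ _ _ hcK hxK
            _ = C1 (j+1) * (|q * x - p1| ^ 2 * (q:ℝ) ^ (-1:ℝ)) := by
                rw [abs_sub_comm, hxc, Real.rpow_neg_one]; field_simp
            _ ≤ C1 (j+1) * (1 ^ 2 * (q:ℝ) ^ (-lam)) := by
                have := hC1 (j+1)
                have h3 : (q:ℝ) ^ (-1:ℝ) ≤ (q:ℝ) ^ (-lam) :=
                  Real.rpow_le_rpow_of_exponent_le hq1' (by linarith)
                gcongr
            _ = _ := by ring
      · exact hp.trans (hQq lam hl.le)

theorem lower_aux (m : ℕ) (a b : ℝ) (hab : a < b) (lam0 lam s' : ℝ)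
    (hm : 1 ≤ m) (h1 : 1 / ((m:ℝ) + 1) ≤ lam0) (h0 : lam0 < lam)
    (hw : 0 < 1 - m * lam) (hs0 : 0 < s') (hs : s' * (1 + lam) < 2 - m * lam) :
    ENNReal.ofReal s' ≤ dimH (SimSet (m+1) (Set.Ioo a b) lam0) := by
  have hm' : (1:ℝ) ≤ m := by exact_mod_cast hm
  have hl0 : 0 < lam0 := lt_of_lt_of_le (by positivity) h1
  have hl : 0 < lam := hl0.trans h0
  have hl1 : lam ≤ 1 := by nlinarith
  have hgt : 1 < lam * (m + 1) := by
    rw [div_le_iff₀ (by positivity)] at h1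
    nlinarith
  obtain ⟨l, hl2, hl3⟩ := exists_between h0
  obtain ⟨s, hs2, hs3⟩ := exists_between ((lt_div_iff₀ (by linarith : 0 < 1 + lam)).2 hs)
  have hs4 := (lt_div_iff₀ (by linarith : 0 < 1 + lam)).1 hs3
  have hs1 : s < 1 := by
    by_contra hh
    push Not at hh
    nlinarith
  let T : ℕ → Set ℝ := fun G => {y | ∃ q : ℕ, G ≤ q ∧ 0 < q ∧ ∀ i ∈ Finset.Icc 1 (m+1),
        distNearestInt ((q:ℝ) * y ^ i) ≤ (q:ℝ) ^ (-l)}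
  refine (mtp_dim a b hab T s s' hs0 hs2 hs1 ?_).trans (dimH_mono ?_)
  · intro G x _ hx ε hε
    exact lower_balls m x lam l s hx hl hl1 hw hl3 hs4 G ε hε
  · rintro y ⟨hy, hyT⟩
    rw [Set.mem_iInter] at hyT
    refine ⟨hy, ?_⟩
    have hlt : ENNReal.ofReal lam0 < ENNReal.ofReal l :=
      (ENNReal.ofReal_lt_ofReal_iff (hl0.trans hl2)).2 hl2
    refine lt_of_lt_of_le hlt ?_
    apply le_sSup
    refine ⟨l, ⟨hl0.trans hl2, ?_⟩, rfl⟩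
    rw [Set.infinite_iff_exists_gt]
    intro G
    obtain ⟨q, hq1, hq2, hq3⟩ := hyT (G+1)
    exact ⟨q, ⟨hq2, hq3⟩, by omega⟩

theorem lower_main (n : ℕ) (hn : 2 ≤ n) (a b : ℝ) (hab : a < b)
    (lam : ℝ) (h1 : 1 / (n : ℝ) ≤ lam) (h2 : lam ≤ 2 / (2 * (n : ℝ) - 1)) :
    ENNReal.ofReal ((2 - ((n : ℝ) - 1) * lam) / (1 + lam)) ≤
    dimH (SimSet n (Set.Ioo a b) lam) := by
  obtain ⟨m, rfl⟩ : ∃ m, n = m + 1 := ⟨n - 1, by omega⟩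
  have hm : 1 ≤ m := by omega
  have hm' : (1:ℝ) ≤ m := by exact_mod_cast hm
  push_cast at *
  have hl : 0 < lam := lt_of_lt_of_le (by positivity) h1
  have hml : m * lam < 1 := by
    rw [le_div_iff₀ (by linarith)] at h2
    nlinarith
  have key : ∀ s' : ℝ, 0 < s' → s' < (2 - ((m:ℝ) + 1 - 1) * lam) / (1 + lam) →
      ENNReal.ofReal s' ≤ dimH (SimSet (m+1) (Set.Ioo a b) lam) := by
    intro s' hs0 hs
    rw [lt_div_iff₀ (by linarith)] at hs
    have c1 : Filter.Tendsto (fun t : ℝ => 2 - m * t - s' * (1 + t)) (nhdsWithin lam (Set.Ioi lam))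
        (nhds (2 - m * lam - s' * (1 + lam))) := by
      apply Filter.Tendsto.mono_left _ nhdsWithin_le_nhds
      apply Continuous.tendsto; fun_prop
    have c2 : Filter.Tendsto (fun t : ℝ => 1 - m * t) (nhdsWithin lam (Set.Ioi lam))
        (nhds (1 - m * lam)) := by
      apply Filter.Tendsto.mono_left _ nhdsWithin_le_nhds
      apply Continuous.tendsto; fun_prop
    obtain ⟨t, ht1, ht2, ht3⟩ := ((c1.eventually_const_lt (by linarith :
        (0:ℝ) < 2 - m * lam - s' * (1 + lam))).and ((c2.eventually_const_lt (by linarith :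
        (0:ℝ) < 1 - m * lam)).and self_mem_nhdsWithin)).exists
    exact lower_aux m a b hab lam t s' hm h1 ht3 ht2 hs0 (by linarith)
  apply le_of_forall_lt
  intro c hc
  have hctop : c ≠ ⊤ := ne_top_of_lt hc
  have hpos : 0 < (2 - ((m:ℝ) + 1 - 1) * lam) / (1 + lam) :=
    div_pos (by linarith) (by linarith)
  have hc2 : c.toReal < (2 - ((m:ℝ) + 1 - 1) * lam) / (1 + lam) := by
    have := (ENNReal.toReal_lt_toReal hctop ENNReal.ofReal_ne_top).2 hc
    rwa [ENNReal.toReal_ofReal hpos.le] at this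
  obtain ⟨s', hs1, hs2⟩ := exists_between hc2
  have hs0 : 0 < s' := lt_of_le_of_lt ENNReal.toReal_nonneg hs1
  refine lt_of_lt_of_le ?_ (key s' hs0 hs2)
  rw [← ENNReal.ofReal_toReal hctop]
  exact (ENNReal.ofReal_lt_ofReal_iff hs0).2 hs1

open MeasureTheory
open scoped ENNReal

/-- Hausdorff content of dimension `d`. -/
noncomputable def hcont (d : ℝ) : OuterMeasure ℝ :=
  OuterMeasure.boundedBy (fun s => Metric.ediam s ^ d)

theorem hcont_le (d : ℝ) (s : Set ℝ) : hcont d s ≤ Metric.ediam s ^ d :=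
  OuterMeasure.boundedBy_le s

theorem hcont_ball (d : ℝ) (hd : 0 < d) (c r : ℝ) (hr : 0 ≤ r) :
    hcont d (Metric.closedBall c r) ≤ ENNReal.ofReal ((2 * r) ^ d) := by
  refine (hcont_le d _).trans ?_
  have h : Metric.ediam (Metric.closedBall c r) ≤ ENNReal.ofReal (2 * r) := by
    rw [Real.closedBall_eq_Icc, Real.ediam_Icc]
    apply ENNReal.ofReal_le_ofReal; linarith
  rw [← ENNReal.ofReal_rpow_of_nonneg (by positivity) hd.le]
  exact ENNReal.rpow_le_rpow h hd.le

theorem hmeas_zero_of_hcont (d : ℝ) (hd : 0 < d) (s : Set ℝ) (h : hcont d s = 0) :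
    μH[d] s = 0 := by
  rw [Measure.hausdorffMeasure_apply]
  simp only [ENNReal.iSup_eq_zero]
  intro r hr
  rw [← nonpos_iff_eq_zero]
  apply le_of_forall_gt
  intro ε hε
  have hrd : 0 < r ^ d := by
    rcases eq_or_ne r ⊤ with h | h
    · rw [h, ENNReal.top_rpow_of_pos hd]; exact ENNReal.zero_lt_top
    · exact ENNReal.rpow_pos hr h
  have h2 : hcont d s < min ε (r ^ d) := by rw [h]; exact lt_min hε hrd
  rw [hcont, OuterMeasure.boundedBy_apply] at h2
  simp only [iInf_lt_iff] at h2
  obtain ⟨t, ht, hlt⟩ := h2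
  have hle : ∀ n, Metric.ediam (t n) ≤ r := by
    intro n
    rcases (t n).eq_empty_or_nonempty with h0 | h0
    · simp [h0]
    · have h3 : (⨆ _ : (t n).Nonempty, Metric.ediam (t n) ^ d) < r ^ d :=
        lt_of_le_of_lt (ENNReal.le_tsum (f := fun n => ⨆ _ : (t n).Nonempty, Metric.ediam (t n) ^ d) n)
          (hlt.trans_le (min_le_right _ _))
      rw [iSup_pos h0] at h3
      exact ((ENNReal.rpow_lt_rpow_iff hd).1 h3).le
  refine lt_of_le_of_lt ?_ (hlt.trans_le (min_le_left _ _))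
  exact iInf_le_of_le t (iInf_le_of_le ht (iInf_le_of_le hle le_rfl))

theorem dimH_le_of_hcont (d : ℝ) (hd : 0 < d) (s : Set ℝ) (h : hcont d s = 0) :
    dimH s ≤ ENNReal.ofReal d := by
  have := hmeas_zero_of_hcont d hd s h
  apply dimH_le_of_hausdorffMeasure_ne_top
  rw [Real.coe_toNNReal d hd.le, this]
  exact ENNReal.zero_ne_top

/-- Summation over cells of length `L`. -/
theorem hcont_cells (d K L : ℝ) (hK : 0 < K) (hL : 0 < L) (hL1 : L ≤ 1) (E : Set ℝ)
    (hE : E ⊆ Set.Icc (-K) K) (β : ℝ) (hβ : 0 ≤ β)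
    (h : ∀ t : ℝ, hcont d (E ∩ Set.Icc t (t + L)) ≤ ENNReal.ofReal β) :
    hcont d E ≤ ENNReal.ofReal ((2 * K + 1) / L * β) := by
  set N := ⌈2 * K / L⌉₊ with hN
  have hsub : E ⊆ ⋃ i ∈ Finset.range N, (E ∩ Set.Icc (-K + i * L) (-K + i * L + L)) := by
    intro x hx
    obtain ⟨h1, h2⟩ := hE hx
    by_cases hxK : x = -K
    · refine Set.mem_iUnion₂.2 ⟨0, ?_, hx, ?_, ?_⟩
      · rw [Finset.mem_range, hN, Nat.ceil_pos]; positivity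
      · simp [hxK]
      · simp [hxK, hL.le]
    have hpos : 0 < (x + K) / L := div_pos (by
      rcases lt_or_eq_of_le h1 with h | h
      · linarith
      · exact absurd h.symm hxK) hL
    set j := ⌈(x + K) / L⌉₊ with hj
    have hj0 : 0 < j := Nat.ceil_pos.2 hpos
    have hj1 : (x + K) / L ≤ j := Nat.le_ceil _
    have hj2 : (j : ℝ) < (x + K) / L + 1 := Nat.ceil_lt_add_one hpos.le
    have hjN : j ≤ N := Nat.ceil_mono (by gcongr; linarith)
    have hc : ((j - 1 : ℕ) : ℝ) = j - 1 := by
      have : 1 ≤ j := hj0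
      push_cast [this]; ring
    rw [div_le_iff₀ hL] at hj1
    have hj3 : ((j:ℝ) - 1) * L < x + K := by
      rw [← lt_div_iff₀ hL]; linarith
    refine Set.mem_iUnion₂.2 ⟨j - 1, ?_, hx, ?_, ?_⟩
    · rw [Finset.mem_range]; omega
    · rw [hc]; linarith
    · rw [hc]; linarith
  calc hcont d E ≤ _ := measure_mono hsub
    _ ≤ ∑ i ∈ Finset.range N, hcont d (E ∩ Set.Icc (-K + i * L) (-K + i * L + L)) :=
        measure_biUnion_finset_le _ _
    _ ≤ ∑ i ∈ Finset.range N, ENNReal.ofReal β := Finset.sum_le_sum fun i _ => h _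
    _ = ENNReal.ofReal (N * β) := by
        rw [Finset.sum_const, Finset.card_range, nsmul_eq_mul, ENNReal.ofReal_mul (by positivity),
          ENNReal.ofReal_natCast]
    _ ≤ _ := by
        apply ENNReal.ofReal_le_ofReal
        gcongr
        have h1 : (N:ℝ) < 2 * K / L + 1 := Nat.ceil_lt_add_one (by positivity)
        have h2 : 1 ≤ 1 / L := by rw [le_div_iff₀ hL]; linarith
        rw [add_div]; linarith

/-- Borel-Cantelli for the content. -/
theorem hcont_limsup (d : ℝ) (S : Set ℝ) (E : ℕ → Set ℝ) (k0 : ℕ) (C θ : ℝ) (hC : 0 ≤ C)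
    (hθ0 : 0 ≤ θ) (hθ : θ < 1)
    (hcov : ∀ x ∈ S, ∃ᶠ k in Filter.atTop, x ∈ E k)
    (hE : ∀ k ≥ k0, hcont d (E k) ≤ ENNReal.ofReal (C * θ ^ k)) : hcont d S = 0 := by
  have h1 : hcont d (Filter.limsup (fun k => E (k + k0)) Filter.atTop) = 0 := by
    apply measure_limsup_atTop_eq_zero
    apply ne_top_of_le_ne_top _
      (ENNReal.tsum_le_tsum (fun k => hE (k + k0) (Nat.le_add_left _ _)))
    have hs : Summable (fun k => C * θ ^ (k + k0)) := by
      apply Summable.mul_left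
      exact (summable_nat_add_iff k0).2 (summable_geometric_of_lt_one hθ0 hθ)
    rw [← ENNReal.ofReal_tsum_of_nonneg (fun k => by positivity) hs]
    exact ENNReal.ofReal_ne_top
  refine measure_mono_null ?_ h1
  intro x hx
  rw [Filter.mem_limsup_iff_frequently_mem]
  have := hcov x hx
  rw [Filter.frequently_atTop] at this ⊢
  intro N
  obtain ⟨k, hk, hxk⟩ := this (N + k0)
  exact ⟨k - k0, by omega, by rwa [Nat.sub_add_cancel (by omega)]⟩

open MeasureTheory
open scoped ENNReal

/-- The character of the torus. -/
noncomputable def tchar {N : ℕ} (k : Fin N → ℤ) (θ : Fin N → ℝ) : ℂ :=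
  Complex.exp (2 * Real.pi * Complex.I * ((∑ i, (k i : ℝ) * θ i : ℝ) : ℂ))

theorem tchar_cont {N : ℕ} (k : Fin N → ℤ) : Continuous (tchar k) := by
  unfold tchar; fun_prop

theorem tchar_prod {N : ℕ} (k : Fin N → ℤ) (θ : Fin N → ℝ) :
    tchar k θ = ∏ i, Complex.exp (2 * Real.pi * Complex.I * (k i) * (θ i : ℂ)) := by
  rw [← Complex.exp_sum, tchar]
  congr 1
  push_cast
  rw [Finset.mul_sum]
  exact Finset.sum_congr rfl fun i _ => by ring

theorem tchar_int_one (m : ℤ) : ∫ t in Set.Ico (0:ℝ) 1,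
    Complex.exp (2 * Real.pi * Complex.I * m * (t : ℂ)) = if m = 0 then 1 else 0 := by
  rw [integral_Ico_eq_integral_Ioc, ← intervalIntegral.integral_of_le zero_le_one]
  split_ifs with h
  · simp [h]
  · have hc : (2 * Real.pi * Complex.I * m : ℂ) ≠ 0 := by
      simp [Real.pi_ne_zero, h]
    rw [integral_exp_mul_complex hc]
    have : (2 * Real.pi * Complex.I * m * ((1:ℝ):ℂ) : ℂ) = m * (2 * Real.pi * Complex.I) := by
      push_cast; ring
    rw [this, Complex.exp_int_mul_two_pi_mul_I]
    simp

theorem tchar_int {N : ℕ} (k : Fin N → ℤ) :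
    ∫ θ in Set.univ.pi (fun _ : Fin N => Set.Ico (0:ℝ) 1), tchar k θ = if k = 0 then 1 else 0 := by
  simp_rw [tchar_prod]
  rw [volume_pi, Measure.restrict_pi_pi]
  rw [integral_fintype_prod_eq_prod (f := fun i (t:ℝ) => Complex.exp (2 * Real.pi * Complex.I * (k i) * (t : ℂ)))]
  simp_rw [tchar_int_one]
  split_ifs with h
  · simp [h]
  · obtain ⟨i, hi⟩ := Function.ne_iff.1 h
    exact Finset.prod_eq_zero (Finset.mem_univ i) (by simpa using hi)

theorem tchar_add {N : ℕ} (k : Fin N → ℤ) (θ : Fin N → ℝ) (z : Fin N → ℤ) :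
    tchar k ((fun i => (z i : ℝ)) + θ) = tchar k θ := by
  unfold tchar
  rw [show (2 * Real.pi * Complex.I * ((∑ i, (k i : ℝ) * ((fun i => (z i : ℝ)) + θ) i : ℝ) : ℂ)) =
    2 * Real.pi * Complex.I * ((∑ i, (k i : ℝ) * θ i : ℝ) : ℂ) + ((∑ i, k i * z i : ℤ) : ℂ) * (2 * Real.pi * Complex.I) by
      simp only [Pi.add_apply, mul_add, Finset.sum_add_distrib]
      push_cast; ring]
  rw [Complex.exp_add, Complex.exp_int_mul_two_pi_mul_I, mul_one]

theorem tchar_mul_conj {N : ℕ} (k l : Fin N → ℤ) (θ : Fin N → ℝ) :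
    tchar k θ * (starRingEnd ℂ) (tchar l θ) = tchar (k - l) θ := by
  unfold tchar
  rw [← Complex.exp_conj, ← Complex.exp_add]
  congr 1
  simp only [map_mul, Complex.conj_ofReal, Complex.conj_I, map_ofNat]
  simp only [Pi.sub_apply]
  push_cast
  simp only [sub_mul, Finset.sum_sub_distrib]
  ring

theorem tsum_sq_int {N : ℕ} (S : Finset (Fin N → ℤ)) :
    ∫⁻ θ in Set.univ.pi (fun _ : Fin N => Set.Ico (0:ℝ) 1),
      ENNReal.ofReal (‖∑ P ∈ S, tchar P θ‖ ^ 2) = S.card := by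
  set D := Set.univ.pi (fun _ : Fin N => Set.Ico (0:ℝ) 1)
  have hDfin : volume D < ⊤ := by
    rw [Real.volume_pi_Ico]; simp
  have : IsFiniteMeasure (volume.restrict D) := ⟨by simpa using hDfin⟩
  have hb : ∀ k : Fin N → ℤ, Integrable (tchar k) (volume.restrict D) := by
    intro k
    refine Integrable.of_bound (tchar_cont k).aestronglyMeasurable 1 (Filter.Eventually.of_forall fun θ => ?_)
    unfold tchar
    rw [show (2 * Real.pi * Complex.I * ((∑ i, (k i : ℝ) * θ i : ℝ) : ℂ)) = ((2 * Real.pi * (∑ i, (k i : ℝ) * θ i) : ℝ) : ℂ) * Complex.I by push_cast; ring, Complex.norm_exp_ofReal_mul_I]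
  have hexp : ∀ θ, ((‖∑ P ∈ S, tchar P θ‖ ^ 2 : ℝ) : ℂ) = ∑ P ∈ S, ∑ P' ∈ S, tchar (P - P') θ := by
    intro θ
    rw [← Complex.normSq_eq_norm_sq, Complex.normSq_eq_conj_mul_self, mul_comm, map_sum, Finset.sum_mul_sum]
    simp_rw [tchar_mul_conj]
  have hI : ∫ θ in D, ((‖∑ P ∈ S, tchar P θ‖ ^ 2 : ℝ) : ℂ) = S.card := by
    simp_rw [hexp]
    rw [integral_finsetSum]
    · have : ∀ P ∈ S, ∫ θ in D, ∑ P' ∈ S, tchar (P - P') θ = 1 := by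
        intro P hP
        rw [integral_finsetSum]
        · simp_rw [D, tchar_int, sub_eq_zero]
          simp [hP]
        · intro P' _; exact hb _
      rw [Finset.sum_congr rfl this]; simp
    · intro P _; exact integrable_finsetSum _ fun P' _ => hb _
  have hI2 : ∫ θ in D, ‖∑ P ∈ S, tchar P θ‖ ^ 2 = S.card := by
    have h := integral_ofReal (𝕜 := ℂ) (μ := volume.restrict D) (f := fun θ => ‖∑ P ∈ S, tchar P θ‖ ^ 2)
    have h2 : ((∫ θ in D, ‖∑ P ∈ S, tchar P θ‖ ^ 2 : ℝ) : ℂ) = ((S.card : ℝ) : ℂ) := by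
      rw [Complex.ofReal_natCast, ← hI]; exact h.symm
    exact_mod_cast h2
  have hintg : Integrable (fun θ => ‖∑ P ∈ S, tchar P θ‖ ^ 2) (volume.restrict D) := by
    refine Integrable.of_bound (C := (S.card:ℝ)^2) ?_ (Filter.Eventually.of_forall fun θ => ?_)
    · exact Continuous.aestronglyMeasurable (by
        have := fun k : Fin N → ℤ => tchar_cont k
        fun_prop)
    · rw [Real.norm_of_nonneg (by positivity)]
      gcongr
      refine (norm_sum_le _ _).trans ?_
      rw [show (S.card:ℝ) = ∑ P ∈ S, (1:ℝ) by simp]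
      refine Finset.sum_le_sum fun k _ => ?_
      unfold tchar
      rw [show (2 * Real.pi * Complex.I * ((∑ i, (k i : ℝ) * θ i : ℝ) : ℂ)) = ((2 * Real.pi * (∑ i, (k i : ℝ) * θ i) : ℝ) : ℂ) * Complex.I by push_cast; ring, Complex.norm_exp_ofReal_mul_I]
  rw [← ofReal_integral_eq_lintegral_ofReal hintg (Filter.Eventually.of_forall fun θ => by positivity), hI2]
  simp

theorem torus_lintegral_le {N : ℕ} (K : Set (Fin N → ℝ)) (hK : MeasurableSet K)
    (F : (Fin N → ℝ) → ℝ≥0∞) (hF : Measurable F)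
    (hper : ∀ (z : Fin N → ℤ) θ, F ((fun i => (z i : ℝ)) + θ) = F θ)
    (hdis : ∀ z : Fin N → ℤ, ∀ θ ∈ K, (fun i => (z i : ℝ)) + θ ∈ K → z = 0) :
    ∫⁻ θ in K, F θ ≤ ∫⁻ θ in Set.univ.pi (fun _ : Fin N => Set.Ico (0:ℝ) 1), F θ := by
  have hD := ZSpan.isAddFundamentalDomain' (Pi.basisFun ℝ (Fin N)) volume
  rw [ZSpan.fundamentalDomain_pi_basisFun] at hD
  have hgz : ∀ g : (Submodule.span ℤ (Set.range (Pi.basisFun ℝ (Fin N)))).toAddSubgroup,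
      ∃ z : Fin N → ℤ, (g : Fin N → ℝ) = fun i => (z i : ℝ) := by
    rintro ⟨g, hg⟩
    have hg' : g ∈ Submodule.span ℤ (Set.range (Pi.basisFun ℝ (Fin N))) := hg
    rw [Module.Basis.mem_span_iff_repr_mem] at hg'
    choose z hz using hg'
    exact ⟨z, funext fun i => by simpa using (hz i).symm⟩
  choose z hz using hgz
  have : Countable (Submodule.span ℤ (Set.range (Pi.basisFun ℝ (Fin N)))).toAddSubgroup := by
    refine Function.Injective.countable (f := z) ?_
    intro a b h
    ext1
    rw [hz a, hz b, h]
  rw [← lintegral_indicator hK, hD.lintegral_eq_tsum'']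
  rw [← lintegral_tsum]
  · refine lintegral_mono fun θ => ?_
    have hsub : ∀ g : (Submodule.span ℤ (Set.range (Pi.basisFun ℝ (Fin N)))).toAddSubgroup, 
        K.indicator F (g +ᵥ θ) = Set.indicator {g | g +ᵥ θ ∈ K} (fun _ => F θ) g := by
      intro g
      by_cases h : g +ᵥ θ ∈ K
      · rw [Set.indicator_of_mem h, Set.indicator_of_mem (show g ∈ {g | g +ᵥ θ ∈ K} from h)]
        change F ((g : Fin N → ℝ) + θ) = F θ
        rw [hz g]; exact hper _ _
      · rw [Set.indicator_of_notMem h, Set.indicator_of_notMem (show g ∉ {g | g +ᵥ θ ∈ K} from h)]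
    simp_rw [hsub]
    by_cases hex : ∃ g0 : (Submodule.span ℤ (Set.range (Pi.basisFun ℝ (Fin N)))).toAddSubgroup, g0 +ᵥ θ ∈ K
    · obtain ⟨g0, hg0⟩ := hex
      rw [tsum_eq_single g0]
      · exact Set.indicator_le_self' (by simp) _
      · intro g hg
        refine Set.indicator_of_notMem ?_ _
        intro hgK
        apply hg
        change (g : Fin N → ℝ) + θ ∈ K at hgK
        change (g0 : Fin N → ℝ) + θ ∈ K at hg0
        have := hdis (z g - z g0) _ hg0 (by
          convert hgK using 1
          rw [hz g, hz g0]
          ext i; simp; ring)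
        ext1
        rw [hz g, hz g0, sub_eq_zero.1 this]
    · push Not at hex
      have : ∀ g : (Submodule.span ℤ (Set.range (Pi.basisFun ℝ (Fin N)))).toAddSubgroup, Set.indicator {g | g +ᵥ θ ∈ K} (fun _ => F θ) g = 0 := fun g =>
        Set.indicator_of_notMem (show g ∉ {g | g +ᵥ θ ∈ K} from hex g) _
      simp [this]
  · intro g
    refine Measurable.aemeasurable ?_
    exact (hF.indicator hK).comp (measurable_const_vadd g)

theorem torus_count (N : ℕ) (hN : 0 < N) (g : Matrix (Fin N) (Fin N) ℝ) (hg : g.det = 1)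
    (Y : Fin N → ℝ) (hY : ∀ i, 0 < Y i) (S : Finset (Fin N → ℤ))
    (y : (Fin N → ℤ) → Fin N → ℝ)
    (hdual : ∀ P ∈ S, ∀ θ : Fin N → ℝ, ∑ i, (P i : ℝ) * θ i = ∑ i, y P i * (g.mulVec θ) i)
    (hyY : ∀ P ∈ S, ∀ i, |y P i| ≤ Y i)
    (hgood : ∀ A : Fin N → ℤ, (∀ i, |(g.mulVec (fun j => (A j : ℝ))) i| ≤ 1 / (4 * N * Y i)) → A = 0) :
    (S.card : ℝ) ≤ 4 * ∏ i, (4 * N * Y i) := by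
  have hN' : (0:ℝ) < N := by exact_mod_cast hN
  set ε : Fin N → ℝ := fun i => 1 / (8 * N * Y i) with hε
  have hεpos : ∀ i, 0 < ε i := fun i => by have := hY i; simp only [hε]; positivity
  set B : Set (Fin N → ℝ) := Set.univ.pi fun i => Set.Icc (-ε i) (ε i) with hB
  set K : Set (Fin N → ℝ) := (Matrix.toLin' g) ⁻¹' B with hK
  have hBm : MeasurableSet B := MeasurableSet.univ_pi fun i => measurableSet_Icc
  have hcont : Continuous (Matrix.toLin' g) := LinearMap.continuous_of_finiteDimensional _
  have hKm : MeasurableSet K := hcont.measurable hBm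
  have hvolB : volume B = ENNReal.ofReal (∏ i, (2 * ε i)) := by
    rw [hB, volume_pi_pi, ENNReal.ofReal_prod_of_nonneg (fun i _ => by have := hεpos i; positivity)]
    refine Finset.prod_congr rfl fun i _ => ?_
    rw [Real.volume_Icc]; congr 1; ring
  have hvolK : volume K = ENNReal.ofReal (∏ i, (2 * ε i)) := by
    rw [hK, Measure.addHaar_preimage_linearMap _ (by rw [LinearMap.det_toLin', hg]; exact one_ne_zero), LinearMap.det_toLin', hg, hvolB]
    simp
  set F : (Fin N → ℝ) → ℝ≥0∞ := fun θ => ENNReal.ofReal (‖∑ P ∈ S, tchar P θ‖ ^ 2) with hF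
  have hFm : Measurable F := by
    have := fun k : Fin N → ℤ => tchar_cont k
    exact (ENNReal.continuous_ofReal.comp (by fun_prop)).measurable
  have hle := torus_lintegral_le K hKm F hFm (by
    intro z θ; simp only [hF, tchar_add]) (by
    intro z θ hθ hzθ
    apply hgood
    intro i
    have h1 : |(g.mulVec θ) i| ≤ ε i := abs_le.2 (hθ i (Set.mem_univ i))
    have h2 : |(g.mulVec ((fun i => (z i : ℝ)) + θ)) i| ≤ ε i := abs_le.2 (hzθ i (Set.mem_univ i))
    rw [Matrix.mulVec_add, Pi.add_apply] at h2
    have h3 : ε i + ε i = 1 / (4 * N * Y i) := by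
      have := hY i
      simp only [hε]; field_simp; norm_num
    rw [← h3]
    rw [abs_le] at *
    constructor <;> linarith)
  rw [hF, tsum_sq_int] at hle
  have hlow : ∀ θ ∈ K, (S.card:ℝ) / 2 ≤ ‖∑ P ∈ S, tchar P θ‖ := by
    intro θ hθ
    refine le_trans ?_ (Complex.re_le_norm _)
    rw [Complex.re_sum, show (S.card:ℝ) / 2 = ∑ P ∈ S, (1/2:ℝ) by simp; ring]
    refine Finset.sum_le_sum fun P hP => ?_
    have hsum : |∑ i, (P i : ℝ) * θ i| ≤ 1 / 8 := by
      rw [hdual P hP]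
      refine (Finset.abs_sum_le_sum_abs _ _).trans ?_
      calc ∑ i, |y P i * (g.mulVec θ) i| ≤ ∑ i : Fin N, 1 / (8 * N : ℝ) := by
            refine Finset.sum_le_sum fun i _ => ?_
            rw [abs_mul]
            have h1 : |(g.mulVec θ) i| ≤ ε i := abs_le.2 (hθ i (Set.mem_univ i))
            calc _ ≤ Y i * ε i := by gcongr; exacts [(hY i).le, hyY P hP i]
              _ = _ := by have := hY i; simp only [hε]; field_simp
        _ = 1 / 8 := by simp; field_simp
    unfold tchar
    rw [show (2 * Real.pi * Complex.I * ((∑ i, (P i : ℝ) * θ i : ℝ) : ℂ)) = ((2 * Real.pi * (∑ i, (P i : ℝ) * θ i) : ℝ) : ℂ) * Complex.I by push_cast; ring, Complex.exp_ofReal_mul_I_re]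
    rw [← Real.cos_abs, ← Real.cos_pi_div_three]
    have hpi := Real.pi_pos
    apply Real.cos_le_cos_of_nonneg_of_le_pi (abs_nonneg _) (by linarith)
    rw [abs_mul, abs_of_pos (by positivity : 0 < 2 * Real.pi)]
    nlinarith
  have h5 : ENNReal.ofReal (((S.card:ℝ) / 2)^2) * volume K ≤ S.card := by
    refine le_trans ?_ hle
    rw [← setLIntegral_const]
    refine setLIntegral_mono hFm fun θ hθ => ?_
    apply ENNReal.ofReal_le_ofReal
    have := hlow θ hθ
    gcongr
  rw [hvolK, ← ENNReal.ofReal_mul (by positivity), ← ENNReal.ofReal_natCast] at h5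
  rw [ENNReal.ofReal_le_ofReal_iff (by positivity)] at h5
  have hprod : (∏ i, (2 * ε i)) * ∏ i, (4 * N * Y i) = 1 := by
    rw [← Finset.prod_mul_distrib]
    refine Finset.prod_eq_one fun i _ => ?_
    have := hY i
    simp only [hε]; field_simp; norm_num
  have hPpos : 0 < ∏ i, (4 * N * Y i) := Finset.prod_pos fun i _ => by have := hY i; positivity
  rcases Nat.eq_zero_or_pos S.card with h0 | h0
  · rw [h0]; push_cast; linarith
  have hc : (0:ℝ) < S.card := by exact_mod_cast h0
  have h6 : ((S.card:ℝ) / 2)^2 * ((∏ i, (2 * ε i)) * ∏ i, (4 * N * Y i)) ≤ S.card * ∏ i, (4 * N * Y i) := by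
    rw [← mul_assoc]; gcongr
  rw [hprod, mul_one] at h6
  have h7 : (S.card:ℝ) * (S.card / 4) ≤ S.card * ∏ i, (4 * N * Y i) := by
    calc _ = ((S.card:ℝ) / 2)^2 := by ring
      _ ≤ _ := h6
  have := le_of_mul_le_mul_left h7 hc
  linarith

open MeasureTheory
open scoped ENNReal

/-- Matrix of Taylor coefficients. -/
noncomputable def tayMat (n : ℕ) (x : ℝ) : Matrix (Fin (n+1)) (Fin (n+1)) ℝ :=
  fun i l => (Nat.choose l i : ℝ) * x ^ ((l:ℕ) - i)

theorem tayMat_det (n : ℕ) (x : ℝ) : (tayMat n x).det = 1 := by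
  rw [Matrix.det_of_isUpperTriangular]
  · simp [tayMat]
  · intro i j hij
    have : (j:ℕ) < i := hij
    simp [tayMat, Nat.choose_eq_zero_of_lt this]

/-- bad points -/
def BadPt (n : ℕ) (Q D x : ℝ) : Prop :=
  ∃ A : Fin (n+1) → ℤ, A ≠ 0 ∧
    ∀ i : Fin (n+1), |((tayMat n x).mulVec (fun j => (A j : ℝ))) i| ≤ 1 / (Q * D ^ (min (i:ℕ) 2))

/-- evaluation functional -/
noncomputable def phiF {n : ℕ} (P : Fin (n+1) → ℝ) (f : Polynomial ℝ) : ℝ :=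
  ∑ j : Fin (n+1), P j * f.coeff j

noncomputable def yF {n : ℕ} (x : ℝ) (P : Fin (n+1) → ℝ) (i : Fin (n+1)) : ℝ :=
  phiF P ((Polynomial.X - Polynomial.C x) ^ (i:ℕ))

theorem yF_dual {n : ℕ} (x : ℝ) (P θ : Fin (n+1) → ℝ) :
    ∑ i, P i * θ i = ∑ i, yF x P i * ((tayMat n x).mulVec θ) i := by
  have hX : ∀ l : Fin (n+1), P l = ∑ i, yF x P i * tayMat n x i l := by
    intro l
    have h1 : (Polynomial.X : Polynomial ℝ) ^ (l:ℕ) = ∑ i : Fin (n+1), Polynomial.C (tayMat n x i l) * (Polynomial.X - Polynomial.C x) ^ (i:ℕ) := by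
      conv_lhs => rw [show (Polynomial.X : Polynomial ℝ) = (Polynomial.X - Polynomial.C x) + Polynomial.C x by ring]
      rw [add_pow]
      unfold tayMat
      rw [Fin.sum_univ_eq_sum_range (fun i => Polynomial.C ((Nat.choose l i : ℝ) * x ^ ((l:ℕ) - i)) * (Polynomial.X - Polynomial.C x) ^ i) (n+1)]
      rw [← Finset.sum_subset (Finset.range_mono (Nat.succ_le_of_lt l.2 : (l:ℕ)+1 ≤ n+1))]
      · refine Finset.sum_congr rfl fun i _ => ?_
        simp only [map_mul, map_natCast, map_pow]
        ring
      · intro i _ hi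
        have : (l:ℕ) < i := by simpa using hi
        simp [Nat.choose_eq_zero_of_lt this]
    have h2 : P l = phiF P (Polynomial.X ^ (l:ℕ)) := by
      unfold phiF
      simp only [Polynomial.coeff_X_pow]
      rw [Finset.sum_eq_single l]
      · simp
      · intro b _ hb
        have : (b:ℕ) ≠ l := fun h => hb (Fin.ext h)
        simp [this]
      · simp
    rw [h2, h1]
    unfold yF phiF
    simp only [Polynomial.finsetSum_coeff, Polynomial.coeff_C_mul, Finset.mul_sum, Finset.sum_mul]
    rw [Finset.sum_comm]
    exact Finset.sum_congr rfl fun i _ => Finset.sum_congr rfl fun j _ => by ring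
  calc ∑ i, P i * θ i = ∑ l, (∑ i, yF x P i * tayMat n x i l) * θ l := 
        Finset.sum_congr rfl fun l _ => by rw [← hX l]
    _ = _ := by
      simp only [Matrix.mulVec, dotProduct, Finset.mul_sum, Finset.sum_mul]
      rw [Finset.sum_comm]
      exact Finset.sum_congr rfl fun i _ => Finset.sum_congr rfl fun j _ => by ring

theorem yF_bound {n : ℕ} (K x x' τ q : ℝ) (hK : 0 ≤ K) (hτ : 0 ≤ τ) (hx : |x| ≤ K) (P : Fin (n+1) → ℝ)
    (hP : ∀ i : Fin (n+1), |q * x' ^ (i:ℕ) - P i| ≤ τ) (i : Fin (n+1)) :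
    |yF x P i| ≤ |q| * |x' - x| ^ (i:ℕ) + (n+1) * ((1+K)^n * 2^n) * τ := by
  have h1 : yF x P i = q * (x' - x) ^ (i:ℕ) - ∑ j : Fin (n+1), (q * x' ^ (j:ℕ) - P j) * ((Polynomial.X - Polynomial.C x) ^ (i:ℕ)).coeff j := by
    have h2 : (x' - x) ^ (i:ℕ) = ∑ j : Fin (n+1), x' ^ (j:ℕ) * ((Polynomial.X - Polynomial.C x) ^ (i:ℕ)).coeff j := by
      have h3 : (x' - x) ^ (i:ℕ) = ((Polynomial.X - Polynomial.C x) ^ (i:ℕ)).eval x' := by simp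
      rw [h3, Polynomial.eval_eq_sum_range' (n := n+1) (by
        rw [Polynomial.natDegree_pow, Polynomial.natDegree_X_sub_C]; have := i.2; omega)]
      rw [Finset.sum_range]
      exact Finset.sum_congr rfl fun j _ => by ring
    rw [h2, Finset.mul_sum, ← Finset.sum_sub_distrib]
    unfold yF phiF
    exact Finset.sum_congr rfl fun j _ => by ring
  rw [h1]
  refine (abs_sub _ _).trans ?_
  rw [abs_mul, abs_pow]
  gcongr
  refine (Finset.abs_sum_le_sum_abs _ _).trans ?_
  calc _ ≤ ∑ j : Fin (n+1), ((1+K)^n * 2^n) * τ := by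
        refine Finset.sum_le_sum fun j _ => ?_
        rw [abs_mul, mul_comm]
        gcongr
        · rw [sub_eq_add_neg, ← Polynomial.C_neg, Polynomial.coeff_X_add_C_pow, abs_mul, abs_pow, abs_neg]
          have hi : (i:ℕ) ≤ n := by have := i.2; omega
          gcongr
          · calc |x| ^ ((i:ℕ) - j) ≤ (1+K) ^ ((i:ℕ) - j) := by gcongr; linarith
              _ ≤ (1+K)^n := by apply pow_le_pow_right₀ (by linarith); omega
          · rw [Nat.abs_cast]
            calc ((Nat.choose i j : ℕ):ℝ) ≤ ((2^(i:ℕ) : ℕ) : ℝ) := by exact_mod_cast Nat.choose_le_two_pow _ _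
              _ = 2^(i:ℕ) := by push_cast; rfl
              _ ≤ 2^n := pow_le_pow_right₀ (by norm_num) hi
        · exact hP j
    _ = _ := by simp; ring

theorem good_count (n : ℕ) (hn : 1 ≤ n) (K : ℝ) (hK : 0 ≤ K) : ∃ C : ℝ, 0 < C ∧ ∀ Q D x : ℝ, 1 ≤ Q → 0 < D → D ≤ 1 →
    |x| ≤ K → ¬ BadPt n Q D x → ∀ S : Finset (Fin (n+1) → ℤ),
    (∀ P ∈ S, |(P 0 : ℝ)| ≤ 2 * Q ∧ ∃ x', |x' - x| ≤ D ∧ ∀ i : Fin (n+1), |(P 0 : ℝ) * x' ^ (i:ℕ) - P i| ≤ Q * D^2) →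
    (S.card : ℝ) ≤ C * Q^(n+1) * D^(2*n-1) := by
  set C1 : ℝ := 2 + (n+1) * ((1+K)^n * 2^n) with hC1
  have hC1' : 2 ≤ C1 := by rw [hC1]; have : 0 ≤ (n+1) * ((1+K)^n * 2^n) := by positivity
                           linarith
  have hC1pos : 0 < C1 := by linarith
  refine ⟨4 * (4 * (n+1) * C1) ^ (n+1), by positivity, ?_⟩
  intro Q D x hQ hD hD1 hx hgood S hS
  have hQ0 : 0 < Q := by linarith
  have hmin : ∀ i : ℕ, D ^ i ≤ D ^ (min i 2) := fun i => pow_le_pow_of_le_one hD.le hD1 (min_le_left _ _)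
  have hmin2 : ∀ i : ℕ, D ^ 2 ≤ D ^ (min i 2) := fun i => pow_le_pow_of_le_one hD.le hD1 (min_le_right _ _)
  have key := torus_count (n+1) (by omega) (tayMat n x) (tayMat_det n x) (fun i => C1 * (Q * D ^ (min (i:ℕ) 2)))
    (fun i => by positivity) S (fun P => yF x (fun i => (P i : ℝ))) (fun P _ θ => yF_dual x _ θ) (by
      intro P hP i
      obtain ⟨hP0, x', hx', hPi⟩ := hS P hP
      refine (yF_bound K x x' (Q * D^2) (P 0) hK (by positivity) hx _ hPi i).trans ?_
      calc |(P 0:ℝ)| * |x' - x| ^ (i:ℕ) + (n+1) * ((1+K)^n * 2^n) * (Q * D^2)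
          ≤ (2 * Q) * D ^ (min (i:ℕ) 2) + (n+1) * ((1+K)^n * 2^n) * (Q * D ^ (min (i:ℕ) 2)) := by
            have h1 : |x' - x| ^ (i:ℕ) ≤ D ^ (min (i:ℕ) 2) := le_trans (by gcongr) (hmin i)
            have := hmin2 i
            gcongr
        _ = _ := by rw [hC1]; ring) (by
      intro A hA
      by_contra hne
      apply hgood
      refine ⟨A, hne, fun i => (hA i).trans ?_⟩
      have hp : 0 < Q * D ^ (min (i:ℕ) 2) := by positivity
      apply one_div_le_one_div_of_le hp
      have h4 : 1 ≤ 4 * ((n+1 : ℕ):ℝ) * C1 := by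
        push_cast
        have : (0:ℝ) ≤ n := by positivity
        nlinarith
      calc Q * D ^ (min (i:ℕ) 2) = 1 * (Q * D ^ (min (i:ℕ) 2)) := by ring
        _ ≤ (4 * ((n+1 : ℕ):ℝ) * C1) * (Q * D ^ (min (i:ℕ) 2)) := by gcongr
        _ = _ := by ring)
  refine key.trans (le_of_eq ?_)
  have hsum : ∀ m : ℕ, ∑ i ∈ Finset.range (m+2), min i 2 = 2*m+1 := by
    intro m
    induction m with
    | zero => decide
    | succ m ih => rw [Finset.sum_range_succ, ih]; omega
  have hp : ∏ i : Fin (n+1), D ^ (min (i:ℕ) 2) = D ^ (2*n-1) := by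
    rw [Finset.prod_pow_eq_pow_sum, Fin.sum_univ_eq_sum_range (fun i => min i 2) (n+1)]
    obtain ⟨m, rfl⟩ : ∃ m, n = m + 1 := ⟨n-1, by omega⟩
    rw [hsum m]; congr 1
  rw [show (fun i : Fin (n+1) => 4 * ((n+1:ℕ):ℝ) * (C1 * (Q * D ^ (min (i:ℕ) 2)))) = fun i : Fin (n+1) => (4 * (n+1) * C1 * Q) * D ^ (min (i:ℕ) 2) by
    ext i; push_cast; ring]
  rw [Finset.prod_mul_distrib, hp]
  simp [mul_pow]
  ring

theorem good_content (n : ℕ) (hn : 1 ≤ n) (K : ℝ) (hK : 0 < K) (s : ℝ) (hs : 0 < s) : ∃ C : ℝ, 0 < C ∧ ∀ Q D : ℝ, 1 ≤ Q → 0 < D → D ≤ 1 →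
    hcont s {x : ℝ | x ∈ Set.Icc (-K) K ∧ ¬ BadPt n Q D x ∧ ∃ P : Fin (n+1) → ℤ, Q ≤ P 0 ∧ (P 0 : ℝ) ≤ 2 * Q ∧
      ∀ i : Fin (n+1), |(P 0 : ℝ) * x ^ (i:ℕ) - P i| ≤ Q * D^2} ≤ ENNReal.ofReal (C * Q^(n+1) * D^(2*n-2) * (D^2)^s) := by
  obtain ⟨C, hC, hcount⟩ := good_count n hn K hK.le
  refine ⟨(2*K+1) * C * 2^s, by positivity, ?_⟩
  intro Q D hQ hD hD1
  have hQ0 : 0 < Q := by linarith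
  set E := {x : ℝ | x ∈ Set.Icc (-K) K ∧ ¬ BadPt n Q D x ∧ ∃ P : Fin (n+1) → ℤ, Q ≤ P 0 ∧ (P 0 : ℝ) ≤ 2 * Q ∧
      ∀ i : Fin (n+1), |(P 0 : ℝ) * x ^ (i:ℕ) - P i| ≤ Q * D^2} with hE
  have := hcont_cells s K D hK hD hD1 E (fun x hx => hx.1) (C * Q^(n+1) * D^(2*n-1) * (2 * D^2)^s) (by positivity) (by
    intro t
    rcases (E ∩ Set.Icc t (t + D)).eq_empty_or_nonempty with h0 | ⟨x, hxE, hxt⟩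
    · rw [h0]; simp
    · set 𝒮 : Set (Fin (n+1) → ℤ) := {P | Q ≤ P 0 ∧ (P 0 : ℝ) ≤ 2 * Q ∧ ∃ x', |x' - x| ≤ D ∧
        ∀ i : Fin (n+1), |(P 0 : ℝ) * x' ^ (i:ℕ) - P i| ≤ Q * D^2} with h𝒮
      have hc : ∀ S : Finset (Fin (n+1) → ℤ), ↑S ⊆ 𝒮 → (S.card:ℝ) ≤ C * Q^(n+1) * D^(2*n-1) := by
        intro S hS
        refine hcount Q D x hQ hD hD1 (abs_le.2 hxE.1) hxE.2.1 S ?_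
        intro P hP
        obtain ⟨h1, h2, h3⟩ := hS hP
        exact ⟨by rw [abs_of_nonneg (by linarith)]; exact h2, h3⟩
      have hfin : 𝒮.Finite := by
        by_contra hinf
        obtain ⟨S, hS, hcard⟩ := Set.Infinite.exists_subset_card_eq hinf (⌊C * Q^(n+1) * D^(2*n-1)⌋₊ + 1)
        have := hc S hS
        rw [hcard] at this
        push_cast at this
        linarith [Nat.lt_floor_add_one (C * Q^(n+1) * D^(2*n-1))]
      have hsub : E ∩ Set.Icc t (t + D) ⊆ ⋃ P ∈ hfin.toFinset, Metric.closedBall ((P 1 : ℝ) / P 0) (D^2) := by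
        rintro x' ⟨⟨_, _, P, hP1, hP2, hP3⟩, hx't⟩
        simp only [Set.mem_iUnion]
        have hP0 : (0:ℝ) < P 0 := by linarith
        refine ⟨P, hfin.mem_toFinset.2 ⟨hP1, hP2, x', ?_, hP3⟩, ?_⟩
        · rw [abs_le]; constructor <;> linarith [hx't.1, hx't.2, hxt.1, hxt.2]
        · rw [Metric.mem_closedBall, Real.dist_eq]
          have h1 := hP3 1
          have hv : ((1 : Fin (n+1)) : ℕ) = 1 := by
            rw [Fin.val_one']; exact Nat.mod_eq_of_lt (by omega)
          rw [hv, pow_one] at h1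
          have h2 : (P 0:ℝ) * |x' - (P 1:ℝ) / P 0| = |(P 0 : ℝ) * x' - P 1| := by
            rw [← abs_of_pos hP0, ← abs_mul, abs_of_pos hP0]; congr 1; field_simp
          have h3 : Q * |x' - (P 1:ℝ) / P 0| ≤ Q * D^2 := by
            refine le_trans ?_ h1
            rw [← h2]; gcongr
          exact le_of_mul_le_mul_left h3 hQ0
      calc hcont s (E ∩ Set.Icc t (t + D)) ≤ _ := measure_mono hsub
        _ ≤ ∑ P ∈ hfin.toFinset, hcont s (Metric.closedBall ((P 1 : ℝ) / P 0) (D^2)) := measure_biUnion_finset_le _ _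
        _ ≤ ∑ P ∈ hfin.toFinset, ENNReal.ofReal ((2 * D^2)^s) := Finset.sum_le_sum fun P _ => hcont_ball s hs _ _ (by positivity)
        _ = ENNReal.ofReal (hfin.toFinset.card * (2 * D^2)^s) := by
          rw [Finset.sum_const, nsmul_eq_mul, ENNReal.ofReal_mul (by positivity), ENNReal.ofReal_natCast]
        _ ≤ _ := by
          apply ENNReal.ofReal_le_ofReal
          have := hc hfin.toFinset (by simp)
          gcongr)
  refine this.trans (ENNReal.ofReal_le_ofReal (le_of_eq ?_))
  rw [Real.mul_rpow (by norm_num) (by positivity)]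
  have h5 : D^(2*n-1) = D^(2*n-2) * D := by
    rw [← pow_succ]; congr 1; omega
  rw [h5]; field_simp

open MeasureTheory
open scoped ENNReal

/-- complex roots of an integer polynomial -/
noncomputable def croots (F : Polynomial ℤ) : Multiset ℂ := (F.map (Int.castRingHom ℂ)).roots

/-- Mahler measure of an integer polynomial -/
noncomputable def mahZ (F : Polynomial ℤ) : ℝ := (F.map (Int.castRingHom ℂ)).mahlerMeasure

/-- truncated distance -/
noncomputable def utr (L x : ℝ) (α : ℂ) : ℝ := max (min 1 ‖(x:ℂ) - α‖) L

/-- truncated product of distances to the roots -/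
noncomputable def VV (L x : ℝ) (F : Polynomial ℤ) : ℝ := ((croots F).map (utr L x)).prod

theorem croots_card (F : Polynomial ℤ) : Multiset.card (croots F) = F.natDegree := by
  unfold croots
  rw [← (IsAlgClosed.splits (F.map (Int.castRingHom ℂ))).natDegree_eq_card_roots]
  exact Polynomial.natDegree_map_eq_of_injective (Int.castRingHom ℂ).injective_int F

theorem mahZ_eq (F : Polynomial ℤ) : mahZ F = |(F.leadingCoeff : ℝ)| * ((croots F).map (fun a => max 1 ‖a‖)).prod := by
  unfold mahZ croots
  rw [Polynomial.mahlerMeasure_eq_leadingCoeff_mul_prod_roots, 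
    Polynomial.leadingCoeff_map_of_injective (Int.castRingHom ℂ).injective_int]
  simp

theorem dist3 (L x x' : ℝ) (hL : 0 < L) (hL1 : L ≤ 1) (h : |x - x'| ≤ L) (α β : ℂ) :
    ‖α - β‖ ≤ 3 * max 1 ‖α‖ * max 1 ‖β‖ * max (utr L x α) (utr L x' β) := by
  have hα : 1 ≤ max 1 ‖α‖ := le_max_left _ _
  have hβ : 1 ≤ max 1 ‖β‖ := le_max_left _ _
  have hα' : ‖α‖ ≤ max 1 ‖α‖ := le_max_right _ _
  have hβ' : ‖β‖ ≤ max 1 ‖β‖ := le_max_right _ _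
  set a := max 1 ‖α‖
  set b := max 1 ‖β‖
  have hab : 1 ≤ a * b := by nlinarith
  set w := max (utr L x α) (utr L x' β) with hw
  have hw1 : min 1 ‖(x:ℂ) - α‖ ≤ w := le_trans (le_max_left _ _) (le_max_left _ _)
  have hw2 : min 1 ‖(x':ℂ) - β‖ ≤ w := le_trans (le_max_left _ _) (le_max_right _ _)
  have hw3 : L ≤ w := le_trans (le_max_right _ _) (le_max_left (utr L x α) (utr L x' β))
  have hbig : 1 ≤ w → ‖α - β‖ ≤ 3 * a * b * w := by
    intro h1
    have h2 := norm_sub_le α β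
    have h3 : a + b ≤ 2 * (a * b) := by nlinarith
    nlinarith
  by_cases h1 : 1 ≤ ‖(x:ℂ) - α‖
  · rw [min_eq_left h1] at hw1; exact hbig hw1
  by_cases h2 : 1 ≤ ‖(x':ℂ) - β‖
  · rw [min_eq_left h2] at hw2; exact hbig hw2
  rw [min_eq_right (not_le.1 h1).le] at hw1
  rw [min_eq_right (not_le.1 h2).le] at hw2
  have h3 : ‖α - β‖ ≤ ‖(x:ℂ) - α‖ + ‖(x:ℂ) - x'‖ + ‖(x':ℂ) - β‖ := by
    have : α - β = -((x:ℂ) - α) + ((x:ℂ) - x') + ((x':ℂ) - β) := by ring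
    rw [this]
    refine (norm_add_le _ _).trans (add_le_add_left ((norm_add_le _ _).trans ?_) _)
    rw [norm_neg]
  have h4 : ‖(x:ℂ) - x'‖ ≤ L := by
    rw [← Complex.ofReal_sub, Complex.norm_real]; exact h
  have h5 : 3 * w ≤ 3 * a * b * w := by
    have : 0 ≤ w := by linarith
    nlinarith
  linarith

theorem dbl_dist (L x x' : ℝ) (hL : 0 < L) (hL1 : L ≤ 1) (h : |x - x'| ≤ L) (R S : Multiset ℂ) :
    (R.map fun α => (S.map fun β => ‖α - β‖).prod).prod ≤
      3 ^ (Multiset.card R * Multiset.card S) * (R.map fun a => max 1 ‖a‖).prod ^ (Multiset.card S) *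
        (S.map fun a => max 1 ‖a‖).prod ^ (Multiset.card R) *
        (R.map fun α => (S.map fun β => max (utr L x α) (utr L x' β)).prod).prod := by
  have hin : ∀ α, (S.map fun β => ‖α - β‖).prod ≤ 3 ^ (Multiset.card S) * (max 1 ‖α‖) ^ (Multiset.card S) * (S.map fun a => max 1 ‖a‖).prod * (S.map fun β => max (utr L x α) (utr L x' β)).prod := by
    intro α
    calc _ ≤ (S.map fun β => 3 * max 1 ‖α‖ * max 1 ‖β‖ * max (utr L x α) (utr L x' β)).prod :=
          Multiset.prod_map_le_prod_map₀ _ _ (fun β _ => norm_nonneg _) (fun β _ => dist3 L x x' hL hL1 h α β)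
      _ = _ := by simp only [Multiset.prod_map_mul, Multiset.map_const', Multiset.prod_replicate, mul_pow]
  calc _ ≤ (R.map fun α => 3 ^ (Multiset.card S) * (max 1 ‖α‖) ^ (Multiset.card S) * (S.map fun a => max 1 ‖a‖).prod * (S.map fun β => max (utr L x α) (utr L x' β)).prod).prod :=
        Multiset.prod_map_le_prod_map₀ _ _ (fun α _ => Multiset.prod_nonneg (by
          intro a ha; obtain ⟨β, _, rfl⟩ := Multiset.mem_map.1 ha; exact norm_nonneg _)) (fun α _ => hin α)
    _ = _ := by
      simp only [Multiset.prod_map_mul, Multiset.map_const', Multiset.prod_replicate, Multiset.prod_map_pow]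
      rw [← pow_mul, mul_comm (Multiset.card S)]

theorem utr_ge (L x : ℝ) (α : ℂ) : L ≤ utr L x α := le_max_right _ _
theorem utr_le (L x : ℝ) (hL1 : L ≤ 1) (α : ℂ) : utr L x α ≤ 1 := max_le (min_le_left _ _) hL1
theorem utr_pos (L x : ℝ) (hL : 0 < L) (α : ℂ) : 0 < utr L x α := hL.trans_le (utr_ge _ _ _)

theorem dbl_w (L x x' : ℝ) (hL : 0 < L) (hL1 : L ≤ 1) (p : ℕ) (P R' P' S' : Multiset ℂ)
    (hP : Multiset.card P = p) (hP' : Multiset.card P' = p)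
    (hPL : ∀ α ∈ P, utr L x α = L) (hPL' : ∀ β ∈ P', utr L x' β = L) :
    ((P + R').map fun α => ((P' + S').map fun β => max (utr L x α) (utr L x' β)).prod).prod * L ^ (p * p) ≤
      ((P + R').map (utr L x)).prod ^ p * ((P' + S').map (utr L x')).prod ^ p := by
  have e1 : (P.map (utr L x)).prod = L ^ p := by
    rw [Multiset.map_congr rfl hPL, Multiset.map_const', Multiset.prod_replicate, hP]
  have hin : ∀ α ∈ P, ((P' + S').map fun β => max (utr L x α) (utr L x' β)).prod = ((P' + S').map (utr L x')).prod := by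
    intro α hα
    congr 1
    refine Multiset.map_congr rfl fun β _ => ?_
    rw [hPL α hα]; exact max_eq_right (utr_ge _ _ _)
  have hin2 : ∀ α, ((P' + S').map fun β => max (utr L x α) (utr L x' β)).prod ≤ utr L x α ^ p := by
    intro α
    rw [Multiset.map_add, Multiset.prod_add]
    have h1 : (P'.map fun β => max (utr L x α) (utr L x' β)).prod = utr L x α ^ p := by
      rw [Multiset.map_congr rfl (g := fun _ => utr L x α) (fun β hβ => by
        rw [hPL' β hβ]; exact max_eq_left (utr_ge _ _ _)), Multiset.map_const', Multiset.prod_replicate, hP']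
    have h2 : (S'.map fun β => max (utr L x α) (utr L x' β)).prod ≤ 1 := by
      calc _ ≤ (S'.map fun β => (1:ℝ)).prod := Multiset.prod_map_le_prod_map₀ _ _ (fun β _ => le_trans (utr_pos L x hL α).le (le_max_left _ _))
              (fun β _ => max_le (utr_le _ _ hL1 _) (utr_le _ _ hL1 _))
        _ = 1 := by simp
    rw [h1]
    have := utr_pos L x hL α
    exact mul_le_of_le_one_right (by positivity) h2
  have hnn : ∀ α, 0 ≤ ((P' + S').map fun β => max (utr L x α) (utr L x' β)).prod := fun α =>
    Multiset.prod_nonneg (by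
      intro a ha; obtain ⟨β, _, rfl⟩ := Multiset.mem_map.1 ha; exact le_trans (utr_pos L x hL α).le (le_max_left _ _))
  have h3 : (R'.map fun α => ((P' + S').map fun β => max (utr L x α) (utr L x' β)).prod).prod ≤ (R'.map (utr L x)).prod ^ p := by
    calc _ ≤ (R'.map fun α => utr L x α ^ p).prod := Multiset.prod_map_le_prod_map₀ _ _ (fun α _ => hnn α) (fun α _ => hin2 α)
      _ = _ := by rw [Multiset.prod_map_pow]
  rw [Multiset.map_add _ P R', Multiset.prod_add, Multiset.map_congr rfl hin, Multiset.map_const', Multiset.prod_replicate, hP,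
    Multiset.map_add (utr L x) P R', Multiset.prod_add, e1, mul_pow, pow_mul]
  have hV' : 0 ≤ ((P' + S').map (utr L x')).prod := Multiset.prod_nonneg (by
      intro a ha; obtain ⟨β, _, rfl⟩ := Multiset.mem_map.1 ha; exact (utr_pos L x' hL β).le)
  calc _ ≤ ((P' + S').map (utr L x')).prod ^ p * (R'.map (utr L x)).prod ^ p * (L^p)^p := by gcongr
    _ = _ := by ring

theorem res_bound (L x x' : ℝ) (hL : 0 < L) (hL1 : L ≤ 1) (h : |x - x'| ≤ L) (m p : ℕ)
    (F G : Polynomial ℤ) (hF : F.natDegree = m) (hG : G.natDegree = m)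
    (P P' : Multiset ℂ) (hPF : P ≤ croots F) (hPG : P' ≤ croots G)
    (hP : Multiset.card P = p) (hP' : Multiset.card P' = p)
    (hPL : ∀ α ∈ P, utr L x α = L) (hPL' : ∀ β ∈ P', utr L x' β = L) :
    |((Polynomial.resultant F G m m : ℤ) : ℝ)| * L ^ (p*p) ≤
      3 ^ (m * m) * (mahZ F ^ m * VV L x F ^ p) * (mahZ G ^ m * VV L x' G ^ p) := by
  obtain ⟨R', hR'⟩ := Multiset.le_iff_exists_add.1 hPF
  obtain ⟨S', hS'⟩ := Multiset.le_iff_exists_add.1 hPG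
  have hcF := croots_card F
  have hcG := croots_card G
  have hres : |((Polynomial.resultant F G m m : ℤ) : ℝ)| = |(F.leadingCoeff : ℝ)| ^ m * |(G.leadingCoeff : ℝ)| ^ m *
      ((croots F).map fun α => ((croots G).map fun β => ‖α - β‖).prod).prod := by
    have h1 := Polynomial.resultant_eq_prod_eval (F.map (Int.castRingHom ℂ)) (G.map (Int.castRingHom ℂ)) m
      (by rw [← hG]; exact Polynomial.natDegree_map_le) (IsAlgClosed.splits _)
    rw [Polynomial.natDegree_map_eq_of_injective (Int.castRingHom ℂ).injective_int, hF, Polynomial.resultant_map_map] at h1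
    have h2 := congrArg norm h1
    rw [norm_mul, norm_pow] at h2
    rw [← Complex.norm_intCast, ← Complex.norm_intCast, ← Complex.norm_intCast]
    rw [Polynomial.leadingCoeff_map_of_injective (Int.castRingHom ℂ).injective_int] at h2
    simp only [eq_intCast] at h2
    rw [h2, mul_assoc]
    congr 1
    change ‖((croots F).map _).prod‖ = _
    have h3 : ∀ α, ‖(G.map (Int.castRingHom ℂ)).eval α‖ = ‖(G.leadingCoeff:ℂ)‖ * ((croots G).map fun β => ‖α - β‖).prod := by
      intro α
      rw [(IsAlgClosed.splits (G.map (Int.castRingHom ℂ))).eval_eq_prod_roots, norm_mul, Polynomial.leadingCoeff_map_of_injective (Int.castRingHom ℂ).injective_int]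
      congr 1
      have := Multiset.prod_hom ((croots G).map fun β => α - β) (normHom : ℂ →*₀ ℝ)
      rw [Multiset.map_map] at this
      exact this.symm
    have h4 := Multiset.prod_hom ((croots F).map fun α => (G.map (Int.castRingHom ℂ)).eval α) (normHom : ℂ →*₀ ℝ)
    rw [Multiset.map_map] at h4
    refine h4.symm.trans ?_
    have h5 : (⇑(normHom : ℂ →*₀ ℝ) ∘ fun α => (G.map (Int.castRingHom ℂ)).eval α) = fun α => ‖(G.leadingCoeff:ℂ)‖ * ((croots G).map fun β => ‖α - β‖).prod := 
      funext h3
    rw [h5, Multiset.prod_map_mul, Multiset.map_const', Multiset.prod_replicate, hcF, hF]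
  have h6 := dbl_dist L x x' hL hL1 h (croots F) (croots G)
  rw [hcF, hcG, hF, hG] at h6
  have h7 := dbl_w L x x' hL hL1 p P R' P' S' hP hP' hPL hPL'
  rw [← hR', ← hS'] at h7
  rw [hres, mahZ_eq, mahZ_eq]
  have hμ : ∀ S : Multiset ℂ, 0 ≤ (S.map fun a => max 1 ‖a‖).prod := fun S => Multiset.prod_nonneg (by
      intro a ha; obtain ⟨β, _, rfl⟩ := Multiset.mem_map.1 ha; positivity)
  have hμF := hμ (croots F)
  have hμG := hμ (croots G)
  unfold VV
  calc _ ≤ |(F.leadingCoeff : ℝ)| ^ m * |(G.leadingCoeff : ℝ)| ^ m * (3 ^ (m * m) * ((croots F).map fun a => max 1 ‖a‖).prod ^ m *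
        ((croots G).map fun a => max 1 ‖a‖).prod ^ m *
        ((croots F).map fun α => ((croots G).map fun β => max (utr L x α) (utr L x' β)).prod).prod) * L ^ (p*p) := by gcongr
    _ = |(F.leadingCoeff : ℝ)| ^ m * |(G.leadingCoeff : ℝ)| ^ m * (3 ^ (m * m) * ((croots F).map fun a => max 1 ‖a‖).prod ^ m *
        ((croots G).map fun a => max 1 ‖a‖).prod ^ m) *
        (((croots F).map fun α => ((croots G).map fun β => max (utr L x α) (utr L x' β)).prod).prod * L ^ (p*p)) := by ring
    _ ≤ |(F.leadingCoeff : ℝ)| ^ m * |(G.leadingCoeff : ℝ)| ^ m * (3 ^ (m * m) * ((croots F).map fun a => max 1 ‖a‖).prod ^ m *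
        ((croots G).map fun a => max 1 ‖a‖).prod ^ m) * (((croots F).map (utr L x)).prod ^ p * ((croots G).map (utr L x')).prod ^ p) := by
          gcongr
    _ = _ := by ring

theorem res_roots (m : ℕ) (hm : 1 ≤ m) (F G : Polynomial ℤ) (hF : F.natDegree = m) (hG : G.natDegree = m)
    (iF : Irreducible F) (iG : Irreducible G) (h0 : Polynomial.resultant F G m m = 0) : croots F = croots G := by
  have hmF : Irreducible (F.map (Int.castRingHom ℚ)) :=
    (Polynomial.IsPrimitive.Int.irreducible_iff_irreducible_map_cast (iF.isPrimitive (by omega))).1 iF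
  have hmG : Irreducible (G.map (Int.castRingHom ℚ)) :=
    (Polynomial.IsPrimitive.Int.irreducible_iff_irreducible_map_cast (iG.isPrimitive (by omega))).1 iG
  have hinj : Function.Injective (Int.castRingHom ℚ) := (Int.castRingHom ℚ).injective_int
  have hnc : ¬ IsCoprime (F.map (Int.castRingHom ℚ)) (G.map (Int.castRingHom ℚ)) := by
    intro hc
    apply Polynomial.resultant_ne_zero _ _ hc
    rw [Polynomial.natDegree_map_eq_of_injective hinj, Polynomial.natDegree_map_eq_of_injective hinj, hF, hG, Polynomial.resultant_map_map, h0]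
    simp
  have hd : F.map (Int.castRingHom ℚ) ∣ G.map (Int.castRingHom ℚ) := by
    by_contra hnd
    exact hnc ((EuclideanDomain.dvd_or_coprime _ _ hmF).resolve_left hnd)
  have hass : Associated (F.map (Int.castRingHom ℚ)) (G.map (Int.castRingHom ℚ)) := hmF.associated_of_dvd hmG hd
  obtain ⟨u, hu⟩ := hass
  obtain ⟨c, hc, hcu⟩ := Polynomial.isUnit_iff.1 u.isUnit
  have hcomp : ∀ H : Polynomial ℤ, H.map (Int.castRingHom ℂ) = (H.map (Int.castRingHom ℚ)).map (algebraMap ℚ ℂ) := by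
    intro H; rw [Polynomial.map_map]; congr 1
  unfold croots
  rw [hcomp G, ← hu, ← hcu, Polynomial.map_mul, ← hcomp, Polynomial.map_C, mul_comm, Polynomial.roots_C_mul]
  simpa using hc.ne_zero

/-- points close to a cluster of `p` roots of an irreducible polynomial of degree `m` -/
def OKset (K σ c : ℝ) (m p j : ℕ) : Set ℝ :=
  {x | x ∈ Set.Icc (-K) K ∧ ∃ F : Polynomial ℤ, Irreducible F ∧ F.natDegree = m ∧
    ∃ P : Multiset ℂ, P ≤ croots F ∧ Multiset.card P = p ∧ (∀ α ∈ P, ‖(x:ℂ) - α‖ ≤ (1/2:ℝ)^j) ∧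
    (mahZ F ^ m * VV (((1/2:ℝ)^j)^σ) x F ^ p)^2 ≤ c * (((1/2:ℝ)^j)^σ)^(p*p)}

theorem mahZ_ge (F : Polynomial ℤ) (hF : F ≠ 0) : 1 ≤ mahZ F :=
  Polynomial.one_le_mahlerMeasure_of_ne_zero hF

theorem VV_pos (L x : ℝ) (hL : 0 < L) (F : Polynomial ℤ) : 0 < VV L x F := by
  unfold VV
  refine Multiset.prod_induction (fun a : ℝ => 0 < a) _ (fun a b ha hb => mul_pos ha hb) one_pos ?_
  intro a ha; obtain ⟨β, _, rfl⟩ := Multiset.mem_map.1 ha; exact utr_pos L x hL β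

theorem VV_ge (L x : ℝ) (hL : 0 < L) (F : Polynomial ℤ) : L ^ F.natDegree ≤ VV L x F := by
  unfold VV
  calc L ^ F.natDegree = ((croots F).map fun _ => L).prod := by
        rw [Multiset.map_const', Multiset.prod_replicate, croots_card]
    _ ≤ _ := Multiset.prod_map_le_prod_map₀ _ _ (fun _ _ => hL.le) (fun α _ => utr_ge _ _ _)

theorem OKset_scale (K σ c : ℝ) (hσ : 0 < σ) (hc : 0 ≤ c) (m p j : ℕ) (x : ℝ)
    (hx : x ∈ OKset K σ c m p j) : (((1/2:ℝ)^j)^σ)^(2*m*p) ≤ c := by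
  obtain ⟨_, F, iF, hF, P, hPF, hP, hPd, hlt⟩ := hx
  set L := ((1/2:ℝ)^j)^σ with hL
  have hL0 : 0 < L := by positivity
  have hL1 : L ≤ 1 := Real.rpow_le_one (by positivity) (pow_le_one₀ (by norm_num) (by norm_num)) hσ.le
  have hV := VV_ge L x hL0 F
  rw [hF] at hV
  have hM := mahZ_ge F iF.ne_zero
  calc L^(2*m*p) = (1 ^ m * (L^m)^p)^2 := by ring
    _ ≤ (mahZ F ^ m * VV L x F ^ p)^2 := by gcongr
    _ ≤ c * L^(p*p) := hlt
    _ ≤ c * 1 := by gcongr; exact pow_le_one₀ hL0.le hL1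
    _ = c := mul_one c

theorem OKset_content (K σ c s : ℝ) (hK : 0 < K) (hσ : 0 < σ) (hσ1 : σ ≤ 1) (hs : 0 < s) (hc : 0 ≤ c)
    (m p j : ℕ) (hm : 1 ≤ m) (hp : 1 ≤ p) (hcm : 3 ^ (m*m) * c < 1) :
    hcont s (OKset K σ c m p j) ≤ ENNReal.ofReal ((2*K+1) / ((1/2:ℝ)^j)^σ * (m * (2 * (1/2:ℝ)^j)^s)) := by
  set M : ℝ := (1/2:ℝ)^j with hM
  have hM0 : 0 < M := by positivity
  have hM1 : M ≤ 1 := pow_le_one₀ (by norm_num) (by norm_num)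
  set L := M^σ with hL
  have hL0 : 0 < L := by positivity
  have hL1 : L ≤ 1 := Real.rpow_le_one hM0.le hM1 hσ.le
  have hML : M ≤ L := by
    calc M = M^(1:ℝ) := (Real.rpow_one M).symm
      _ ≤ M^σ := Real.rpow_le_rpow_of_exponent_ge hM0 hM1 hσ1
  have hutr : ∀ (x : ℝ) (α : ℂ), ‖(x:ℂ) - α‖ ≤ M → utr L x α = L := by
    intro x α h
    exact max_eq_right ((min_le_right _ _).trans (h.trans hML))
  refine hcont_cells s K L hK hL0 hL1 _ (fun x hx => hx.1) _ (by positivity) ?_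
  intro t
  rcases (OKset K σ c m p j ∩ Set.Icc t (t + L)).eq_empty_or_nonempty with h0 | ⟨x0, hx0, hx0t⟩
  · rw [h0]; simp
  obtain ⟨_, F, iF, hF, P, hPF, hP, hPd, hlt⟩ := hx0
  have hsub : OKset K σ c m p j ∩ Set.Icc t (t + L) ⊆ ⋃ α ∈ (croots F).toFinset, Metric.closedBall α.re M := by
    rintro x ⟨⟨_, G, iG, hG, P', hPG, hP', hPd', hlt'⟩, hxt⟩
    have hdist : |x0 - x| ≤ L := by
      rw [abs_le]; constructor <;> linarith [hxt.1, hxt.2, hx0t.1, hx0t.2]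
    have hb := res_bound L x0 x hL0 hL1 hdist m p F G hF hG P P' hPF hPG hP hP'
      (fun α hα => hutr _ _ (hPd α hα)) (fun α hα => hutr _ _ (hPd' α hα))
    have hXX : (mahZ F ^ m * VV L x0 F ^ p) * (mahZ G ^ m * VV L x G ^ p) ≤ c * L^(p*p) := by
      have := sq_nonneg ((mahZ F ^ m * VV L x0 F ^ p) - (mahZ G ^ m * VV L x G ^ p))
      nlinarith
    have hLp : 0 < L^(p*p) := by positivity
    have hlt1 : |((Polynomial.resultant F G m m : ℤ) : ℝ)| < 1 := by
      have h1 : |((Polynomial.resultant F G m m : ℤ) : ℝ)| * L ^ (p*p) ≤ (3 ^ (m * m) * c) * L^(p*p) := by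
        refine hb.trans ?_
        rw [mul_assoc, mul_assoc (3 ^ (m*m)) c]
        exact mul_le_mul_of_nonneg_left hXX (by positivity)
      exact (le_of_mul_le_mul_right h1 hLp).trans_lt hcm
    have hz : Polynomial.resultant F G m m = 0 := by
      have h2 : |Polynomial.resultant F G m m| < 1 := by exact_mod_cast hlt1
      exact Int.abs_lt_one_iff.1 h2
    have hr := res_roots m hm F G hF hG iF iG hz
    obtain ⟨α, hα⟩ := Multiset.card_pos_iff_exists_mem.1 (by rw [hP']; omega : 0 < Multiset.card P')
    simp only [Set.mem_iUnion]
    refine ⟨α, Multiset.mem_toFinset.2 (hr ▸ Multiset.mem_of_le hPG hα), ?_⟩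
    rw [Metric.mem_closedBall, Real.dist_eq]
    refine le_trans ?_ (hPd' α hα)
    have := Complex.abs_re_le_norm ((x:ℂ) - α)
    simpa using this
  calc _ ≤ hcont s (⋃ α ∈ (croots F).toFinset, Metric.closedBall α.re M) := measure_mono hsub
    _ ≤ ∑ α ∈ (croots F).toFinset, hcont s (Metric.closedBall α.re M) := measure_biUnion_finset_le _ _
    _ ≤ ∑ α ∈ (croots F).toFinset, ENNReal.ofReal ((2 * M)^s) := Finset.sum_le_sum fun P _ => hcont_ball s hs _ _ hM0.le
    _ = ENNReal.ofReal ((croots F).toFinset.card * (2 * M)^s) := by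
          rw [Finset.sum_const, nsmul_eq_mul, ENNReal.ofReal_mul (by positivity), ENNReal.ofReal_natCast]
    _ ≤ _ := by
      apply ENNReal.ofReal_le_ofReal
      have : (croots F).toFinset.card ≤ m := by
        rw [← hF, ← croots_card]; exact Multiset.toFinset_card_le _
      have : ((croots F).toFinset.card : ℝ) ≤ m := by exact_mod_cast this
      gcongr

open MeasureTheory
open scoped ENNReal

/-- polynomial from coefficients -/
noncomputable def polyOf {n : ℕ} (A : Fin (n+1) → ℤ) : Polynomial ℤ :=
  ∑ i : Fin (n+1), Polynomial.monomial (i:ℕ) (A i)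

theorem polyOf_coeff {n : ℕ} (A : Fin (n+1) → ℤ) (i : Fin (n+1)) : (polyOf A).coeff i = A i := by
  unfold polyOf
  simp only [Polynomial.finsetSum_coeff, Polynomial.coeff_monomial]
  rw [Finset.sum_eq_single i]
  · simp
  · intro b _ hb
    have : (b:ℕ) ≠ i := fun h => hb (Fin.ext h)
    simp [this]
  · simp

theorem polyOf_deg {n : ℕ} (A : Fin (n+1) → ℤ) : (polyOf A).natDegree ≤ n := by
  unfold polyOf
  refine Polynomial.natDegree_sum_le_of_forall_le _ _ fun i _ => ?_
  refine (Polynomial.natDegree_monomial_le _).trans ?_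
  have := i.2; omega

theorem polyOf_ne {n : ℕ} (A : Fin (n+1) → ℤ) (hA : A ≠ 0) : polyOf A ≠ 0 := by
  intro h
  apply hA
  ext i
  rw [← polyOf_coeff A i, h]; simp

theorem polyOf_eval {n : ℕ} (A : Fin (n+1) → ℤ) (y : ℝ) :
    ‖((polyOf A).map (Int.castRingHom ℂ)).eval (y:ℂ)‖ = |∑ i : Fin (n+1), y ^ (i:ℕ) * (A i : ℝ)| := by
  have : ((polyOf A).map (Int.castRingHom ℂ)).eval (y:ℂ) = ((∑ i : Fin (n+1), y ^ (i:ℕ) * (A i : ℝ) : ℝ) : ℂ) := by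
    unfold polyOf
    rw [Polynomial.map_sum, Polynomial.eval_finsetSum]
    push_cast
    refine Finset.sum_congr rfl fun i _ => ?_
    simp [mul_comm]
  rw [this, Complex.norm_real, Real.norm_eq_abs]

theorem tay_eval {n : ℕ} (Q D K x y : ℝ) (hQ : 0 < Q) (hD : 0 < D) (hD1 : D ≤ 1) (hK : 0 ≤ K) (hx : |x| ≤ K) (hy : |y - x| ≤ D) (A : Fin (n+1) → ℤ)
    (hA : ∀ i : Fin (n+1), |((tayMat n x).mulVec (fun j => (A j : ℝ))) i| ≤ 1 / (Q * D ^ (min (i:ℕ) 2))) :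
    |∑ i : Fin (n+1), y ^ (i:ℕ) * (A i : ℝ)| ≤ (n+1) / Q := by
  rw [yF_dual x (fun i : Fin (n+1) => y ^ (i:ℕ)) (fun j => (A j : ℝ))]
  refine (Finset.abs_sum_le_sum_abs _ _).trans ?_
  calc _ ≤ ∑ i : Fin (n+1), 1 / Q := by
        refine Finset.sum_le_sum fun i _ => ?_
        rw [abs_mul]
        have h1 := yF_bound K x y 0 1 hK le_rfl hx (fun i : Fin (n+1) => y ^ (i:ℕ)) (by simp) i
        simp only [abs_one, one_mul, mul_zero, add_zero] at h1
        calc _ ≤ D ^ (min (i:ℕ) 2) * (1 / (Q * D ^ (min (i:ℕ) 2))) := by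
              have h2 := hA i
              have h3 : |yF x (fun i : Fin (n+1) => y ^ (i:ℕ)) i| ≤ D ^ (min (i:ℕ) 2) := by
                refine h1.trans ?_
                calc |y - x| ^ (i:ℕ) ≤ D ^ (i:ℕ) := by gcongr
                  _ ≤ _ := pow_le_pow_of_le_one hD.le hD1 (min_le_left _ _)
              gcongr
          _ = 1 / Q := by field_simp
    _ = _ := by simp; field_simp

theorem tay_coeff {n : ℕ} (Q D K x : ℝ) (hQ : 0 < Q) (hD : 0 < D) (hD1 : D ≤ 1) (hK : 0 ≤ K) (hx : |x| ≤ K) (A : Fin (n+1) → ℤ)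
    (hA : ∀ i : Fin (n+1), |((tayMat n x).mulVec (fun j => (A j : ℝ))) i| ≤ 1 / (Q * D ^ (min (i:ℕ) 2))) (l : Fin (n+1)) :
    |(A l : ℝ)| ≤ (n+1) * ((n+1) * ((1+K)^n * 2^n)) * (1 / (Q * D^2)) := by
  have h0 : (A l : ℝ) = ∑ i, (Pi.single l (1:ℝ) : Fin (n+1) → ℝ) i * (A i : ℝ) := by
    rw [Finset.sum_eq_single l]
    · simp
    · intro b _ hb; simp [hb]
    · simp
  rw [h0, yF_dual x _ (fun j => (A j : ℝ))]
  refine (Finset.abs_sum_le_sum_abs _ _).trans ?_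
  calc _ ≤ ∑ i : Fin (n+1), ((n+1) * ((1+K)^n * 2^n)) * (1 / (Q * D^2)) := by
        refine Finset.sum_le_sum fun i _ => ?_
        rw [abs_mul]
        have h1 := yF_bound K x 0 1 0 hK zero_le_one hx (Pi.single l (1:ℝ) : Fin (n+1) → ℝ) (by
          intro i
          by_cases h : i = l
          · subst h; simp
          · simp [h]) i
        simp only [abs_zero, zero_mul, zero_add, mul_one] at h1
        have h2 := (hA i).trans (one_div_le_one_div_of_le (by positivity : 0 < Q * D^2) (show Q * D^2 ≤ Q * D ^ (min (i:ℕ) 2) by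
          have := pow_le_pow_of_le_one hD.le hD1 (min_le_right (i:ℕ) 2)
          gcongr))
        gcongr
    _ = _ := by simp; ring

theorem far_point (n : ℕ) (R : Multiset ℂ) (hR : Multiset.card R ≤ n) (x D : ℝ) (hD : 0 < D) :
    ∃ y : ℝ, x ≤ y ∧ y ≤ x + D ∧ ∀ α ∈ R, D / (2 * (n+1)) ≤ ‖(y:ℂ) - α‖ := by
  by_contra hcon
  push Not at hcon
  set yj : Fin (n+1) → ℝ := fun j => x + j * (D / (n+1)) with hyj
  have h1 : ∀ j : Fin (n+1), ∃ α ∈ R.toFinset, ‖(yj j:ℂ) - α‖ < D / (2 * (n+1)) := by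
    intro j
    have hj : ((j:ℕ):ℝ) ≤ n + 1 := by have := j.2; exact_mod_cast this.le
    obtain ⟨α, hα, h⟩ := hcon (yj j) (by simp only [hyj]; have : 0 ≤ (j:ℝ) * (D / (n+1)) := by positivity
                                         linarith) (by
      simp only [hyj]
      have : (j:ℝ) * (D / (n+1)) ≤ (n+1) * (D / (n+1)) := by gcongr
      have h2 : (n+1:ℝ) * (D / (n+1)) = D := by field_simp
      linarith)
    exact ⟨α, Multiset.mem_toFinset.2 hα, h⟩
  choose f hf hf2 using h1
  obtain ⟨j, _, j', _, hne, heq⟩ := Finset.exists_ne_map_eq_of_card_lt_of_maps_to (s := (Finset.univ : Finset (Fin (n+1)))) (t := R.toFinset) (f := f)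
    (by rw [Finset.card_univ, Fintype.card_fin]; exact lt_of_le_of_lt (Multiset.toFinset_card_le R) (by omega)) (fun j _ => hf j)
  have h2 : ‖(yj j:ℂ) - yj j'‖ < D / (n+1) := by
    have e : (yj j:ℂ) - yj j' = ((yj j:ℂ) - f j) - ((yj j':ℂ) - f j') := by rw [heq]; ring
    rw [e]
    refine (norm_sub_le _ _).trans_lt ?_
    have := add_lt_add (hf2 j) (hf2 j')
    have e2 : D / (2 * (n+1:ℝ)) + D / (2 * (n+1)) = D / (n+1) := by field_simp; norm_num
    linarith
  rw [← Complex.ofReal_sub, Complex.norm_real, Real.norm_eq_abs] at h2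
  have h3 : yj j - yj j' = (((j:ℕ):ℤ) - ((j':ℕ):ℤ) : ℤ) * (D / (n+1)) := by simp only [hyj]; push_cast; ring
  have hpos : 0 < D / (n+1) := by positivity
  rw [h3, abs_mul, abs_of_pos hpos] at h2
  have h4 : (1:ℝ) ≤ |((((j:ℕ):ℤ) - ((j':ℕ):ℤ) : ℤ) : ℝ)| := by
    have : ((j:ℕ):ℤ) - ((j':ℕ):ℤ) ≠ 0 := by
      intro h; apply hne; ext; omega
    exact_mod_cast Int.one_le_abs this
  nlinarith

theorem small_mahprod (n : ℕ) (K Q D x : ℝ) (hK : 0 ≤ K) (hD : 0 < D) (hD1 : D ≤ 1) (hx : |x| ≤ K)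
    (F : Polynomial ℤ) (hdeg : F.natDegree ≤ n)
    (hsm : ∀ y : ℝ, |y - x| ≤ D → ‖(F.map (Int.castRingHom ℂ)).eval (y:ℂ)‖ ≤ (n+1) / Q) :
    mahZ F * VV D x F ≤ (2 * (K+1) * (2*n+3) + 2)^n * ((n+1) / Q) := by
  obtain ⟨y, hy1, hy2, hfar⟩ := far_point n (croots F) (by rw [croots_card]; exact hdeg) x D hD
  have hyx : |y - x| ≤ D := by rw [abs_le]; constructor <;> linarith
  have hev := hsm y hyx
  have h3 : ‖(F.map (Int.castRingHom ℂ)).eval (y:ℂ)‖ = |(F.leadingCoeff:ℝ)| * ((croots F).map fun β => ‖(y:ℂ) - β‖).prod := by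
    rw [(IsAlgClosed.splits (F.map (Int.castRingHom ℂ))).eval_eq_prod_roots, norm_mul, Polynomial.leadingCoeff_map_of_injective (Int.castRingHom ℂ).injective_int,
      eq_intCast, Complex.norm_intCast]
    congr 1
    have := Multiset.prod_hom ((croots F).map fun β => (y:ℂ) - β) (normHom : ℂ →*₀ ℝ)
    rw [Multiset.map_map] at this
    exact this.symm
  set B : ℝ := 2 * (K+1) * (2*n+3) + 2 with hB
  have hB1 : 1 ≤ B := by
    have : 0 ≤ 2 * (K+1) * (2*n+3) := by positivity
    linarith
  have hpt : ∀ α ∈ croots F, max 1 ‖α‖ * utr D x α ≤ B * ‖(y:ℂ) - α‖ := by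
    intro α hα
    have hr := hfar α hα
    set r := ‖(y:ℂ) - α‖ with hrdef
    have hr0 : 0 < r := lt_of_lt_of_le (by positivity) hr
    have hDr : D ≤ 2 * (n+1) * r := by
      rw [div_le_iff₀ (by positivity)] at hr; linarith
    have hxα : ‖(x:ℂ) - α‖ ≤ r + D := by
      have e : (x:ℂ) - α = ((y:ℂ) - α) - ((y - x : ℝ):ℂ) := by push_cast; ring
      rw [e]
      refine (norm_sub_le _ _).trans ?_
      rw [Complex.norm_real, Real.norm_eq_abs]
      linarith
    have hu : utr D x α ≤ (2*n+3) * r := by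
      unfold utr
      apply max_le
      · refine (min_le_right _ _).trans ?_; linarith
      · linarith
    have hu1 := utr_le D x hD1 α
    have hu0 := utr_pos D x hD α
    rcases le_or_gt ‖α‖ (2 * (K+1)) with h | h
    · have hm : max 1 ‖α‖ ≤ 2 * (K+1) := max_le (by linarith) h
      calc _ ≤ 2 * (K+1) * ((2*n+3) * r) := by gcongr
        _ ≤ _ := by rw [hB]; nlinarith
    · have hy' : ‖(y:ℂ)‖ ≤ K + 1 := by
        rw [Complex.norm_real, Real.norm_eq_abs]
        have := abs_sub_abs_le_abs_sub y x
        linarith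
      have h5 : ‖α‖ ≤ r + ‖(y:ℂ)‖ := by
        have e : α = (y:ℂ) - ((y:ℂ) - α) := by ring
        calc ‖α‖ = ‖(y:ℂ) - ((y:ℂ) - α)‖ := by rw [← e]
          _ ≤ _ := by refine (norm_sub_le _ _).trans ?_; linarith
      have hm : max 1 ‖α‖ = ‖α‖ := max_eq_right (by linarith)
      rw [hm]
      have h6 : ‖α‖ ≤ 2 * r := by linarith
      have h7 : 0 ≤ 2 * (K+1) * (2*n+3) * r := by positivity
      have h8 : ‖α‖ * utr D x α ≤ ‖α‖ * 1 := by gcongr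
      rw [hB]; nlinarith
  rw [mahZ_eq, VV, mul_assoc, ← Multiset.prod_map_mul]
  calc _ ≤ |(F.leadingCoeff:ℝ)| * ((croots F).map fun α => B * ‖(y:ℂ) - α‖).prod := by
        gcongr
        refine Multiset.prod_map_le_prod_map₀ _ _ (fun α _ => ?_) hpt
        have := utr_pos D x hD α
        positivity
    _ = B ^ F.natDegree * ‖(F.map (Int.castRingHom ℂ)).eval (y:ℂ)‖ := by
      rw [Multiset.prod_map_mul, Multiset.map_const', Multiset.prod_replicate, croots_card, h3]; ring
    _ ≤ B ^ n * ((n+1) / Q) := by gcongr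

theorem bad_small (n : ℕ) (K : ℝ) (hK : 0 ≤ K) : ∃ C : ℝ, 1 ≤ C ∧ ∀ Q D x : ℝ, 0 < Q → 0 < D → D ≤ 1 → |x| ≤ K →
    BadPt n Q D x → ∃ F : Polynomial ℤ, F ≠ 0 ∧ F.natDegree ≤ n ∧ mahZ F * VV D x F ≤ C / Q ∧ mahZ F ≤ C / (Q * D^2) := by
  set C1 : ℝ := (2 * (K+1) * (2*n+3) + 2)^n * (n+1) with hC1
  set C2 : ℝ := (n+1) * ((n+1) * ((n+1) * ((1+K)^n * 2^n))) with hC2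
  have hC1p : 0 ≤ C1 := by positivity
  have hC2p : 0 ≤ C2 := by positivity
  refine ⟨1 + C1 + C2, by linarith, ?_⟩
  intro Q D x hQ hD hD1 hx ⟨A, hA0, hA⟩
  refine ⟨polyOf A, polyOf_ne A hA0, polyOf_deg A, ?_, ?_⟩
  · refine (small_mahprod n K Q D x hK hD hD1 hx (polyOf A) (polyOf_deg A) (fun y hy => ?_)).trans ?_
    · rw [polyOf_eval]; exact tay_eval Q D K x y hQ hD hD1 hK hx hy A hA
    · rw [← mul_div_assoc, ← hC1]; gcongr; linarith
  · unfold mahZ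
    refine (Polynomial.mahlerMeasure_le_sum_norm_coeff _).trans ?_
    rw [Polynomial.sum_over_range' _ (by simp) (n+1) (by
      have := (Polynomial.natDegree_map_le (f := Int.castRingHom ℂ) (p := polyOf A)).trans (polyOf_deg A)
      omega)]
    rw [Finset.sum_range]
    calc _ ≤ ∑ i : Fin (n+1), (n+1) * ((n+1) * ((1+K)^n * 2^n)) * (1 / (Q * D^2)) := by
          refine Finset.sum_le_sum fun i _ => ?_
          rw [Polynomial.coeff_map, polyOf_coeff, eq_intCast, Complex.norm_intCast]
          exact tay_coeff Q D K x hQ hD hD1 hK hx A hA i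
      _ = C2 / (Q * D^2) := by simp [hC2]; ring
      _ ≤ _ := by gcongr; linarith

open MeasureTheory
open scoped ENNReal

/-- logarithmic closeness -/
noncomputable def dl (L x : ℝ) (α : ℂ) : ℝ := - Real.log (utr L x α)

theorem neg_log_prod (S : Multiset ℂ) (f : ℂ → ℝ) (hf : ∀ a, 0 < f a) :
    - Real.log (S.map f).prod = (S.map fun a => - Real.log (f a)).sum := by
  induction S using Multiset.induction_on with
  | empty => simp
  | cons a S ih =>
    have hp : 0 < (S.map f).prod := by
      refine Multiset.prod_induction (fun a : ℝ => 0 < a) _ (fun a b ha hb => mul_pos ha hb) one_pos ?_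
      intro a ha; obtain ⟨β, _, rfl⟩ := Multiset.mem_map.1 ha; exact hf β
    rw [Multiset.map_cons, Multiset.prod_cons, Multiset.map_cons, Multiset.sum_cons, Real.log_mul (hf a).ne' hp.ne', ← ih]
    ring

theorem VV_log (L x : ℝ) (hL : 0 < L) (F : Polynomial ℤ) :
    - Real.log (VV L x F) = ((croots F).map (dl L x)).sum :=
  neg_log_prod _ _ (utr_pos L x hL)

theorem dl_nonneg (L x : ℝ) (hL : 0 < L) (hL1 : L ≤ 1) (α : ℂ) : 0 ≤ dl L x α := by
  have := Real.log_nonpos (utr_pos L x hL α).le (utr_le L x hL1 α)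
  unfold dl; linarith

theorem dl_le (L x : ℝ) (hL : 0 < L) (α : ℂ) : dl L x α ≤ - Real.log L := by
  have := Real.log_le_log hL (utr_ge L x α)
  unfold dl; linarith

theorem dl_compare (D x σ μ L : ℝ) (hD : 0 < D) (hD1 : D ≤ 1) (hσ : 0 < σ) (hσ1 : σ ≤ 1) (hL : 0 < L) (hlog : - Real.log L = σ * μ)
    (α : ℂ) : σ * min (dl D x α) μ ≤ dl L x α := by
  rcases le_or_gt (min 1 ‖(x:ℂ) - α‖) L with h | h
  · have : utr L x α = L := max_eq_right h
    rw [dl.eq_1 L, this, hlog]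
    have := min_le_right (dl D x α) μ
    gcongr
  · have : utr L x α = min 1 ‖(x:ℂ) - α‖ := max_eq_left h.le
    have h1 : utr L x α ≤ utr D x α := by rw [this]; exact le_max_left _ _
    have h2 := Real.log_le_log (utr_pos L x hL α) h1
    have h3 := dl_nonneg D x hD hD1 α
    have h4 := min_le_left (dl D x α) μ
    have h5 : dl D x α ≤ dl L x α := by unfold dl; linarith
    nlinarith

theorem msum_le (S : Multiset ℂ) (f g : ℂ → ℝ) (h : ∀ a ∈ S, f a ≤ g a) : (S.map f).sum ≤ (S.map g).sum :=
  Multiset.sum_map_le_sum_map f g h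

theorem notok_p (K σ E x D : ℝ) (hD : 0 < D) (hD1 : D ≤ 1) (hσ : 0 < σ) (hσ1 : σ ≤ 1)
    (hx : x ∈ Set.Icc (-K) K) (F : Polynomial ℤ) (iF : Irreducible F) (m p j : ℕ) (hm : F.natDegree = m) (hj : 1 ≤ j) (hp : 1 ≤ p)
    (hno : x ∉ OKset K σ (Real.exp (-2*E)) m p j) (P R : Multiset ℂ) (hPR : croots F = P + R)
    (hP : Multiset.card P = p) (hPδ : ∀ α ∈ P, j * Real.log 2 ≤ dl D x α) (hRδ : ∀ α ∈ R, dl D x α ≤ j * Real.log 2 + Real.log 2) :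
    p * (σ * (R.map (dl D x)).sum) ≤ m * Real.log (mahZ F) + E - p * p * σ * (j * Real.log 2) / 2 + p * m := by
  have hl2 : 0 < Real.log 2 := Real.log_pos (by norm_num)
  have hl2' : Real.log 2 ≤ 1 := by have := Real.log_two_lt_d9; linarith
  set μ : ℝ := j * Real.log 2 with hμ
  have hμ0 : 0 < μ := by have : (1:ℝ) ≤ j := by exact_mod_cast hj
                         positivity
  set M : ℝ := (1/2:ℝ)^j with hM
  have hM0 : 0 < M := by positivity
  have hlogM : Real.log M = - μ := by rw [hM, Real.log_pow, one_div, Real.log_inv]; ring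
  set L := M^σ with hL
  have hL0 : 0 < L := by positivity
  have hlogL : - Real.log L = σ * μ := by rw [hL, Real.log_rpow hM0, hlogM]; ring
  have hclose : ∀ α ∈ P, ‖(x:ℂ) - α‖ ≤ M := by
    intro α hα
    have h1 := hPδ α hα
    have h2 : Real.log (utr D x α) ≤ Real.log M := by rw [hlogM]; unfold dl at h1; linarith
    have h3 := (Real.log_le_log_iff (utr_pos D x hD α) hM0).1 h2
    have h4 : min 1 ‖(x:ℂ) - α‖ ≤ M := (le_max_left _ _).trans h3
    have hM1 : M < 1 := pow_lt_one₀ (by norm_num) (by norm_num) (by omega)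
    rcases min_le_iff.1 h4 with h | h
    · linarith
    · exact h
  have hgt : Real.exp (-2*E) * L^(p*p) < (mahZ F ^ m * VV L x F ^ p)^2 := by
    by_contra hle
    exact hno ⟨hx, F, iF, hm, P, by rw [hPR]; exact Multiset.le_add_right _ _, hP, hclose, not_lt.1 hle⟩
  have hmz : 1 ≤ mahZ F := mahZ_ge F iF.ne_zero
  have hV := VV_pos L x hL0 F
  have hlog := Real.log_lt_log (by positivity) hgt
  rw [Real.log_mul (by positivity) (by positivity), Real.log_exp, Real.log_pow, Real.log_pow, Real.log_mul (by positivity) (by positivity),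
    Real.log_pow, Real.log_pow] at hlog
  have hW := VV_log L x hL0 F
  have hlow : p * (σ * μ) + σ * (R.map (dl D x)).sum - m ≤ - Real.log (VV L x F) := by
    rw [hW, hPR, Multiset.map_add, Multiset.sum_add]
    have h1 : p * (σ * μ) ≤ (P.map (dl L x)).sum := by
      calc p * (σ * μ) = (P.map fun _ => σ * μ).sum := by rw [Multiset.map_const', Multiset.sum_replicate, hP, nsmul_eq_mul]
        _ ≤ _ := msum_le _ _ _ fun α hα => by
          refine le_trans ?_ (dl_compare D x σ μ L hD hD1 hσ hσ1 hL0 hlogL α)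
          rw [min_eq_right (hPδ α hα)]
    have h2 : σ * (R.map (dl D x)).sum - Multiset.card R ≤ (R.map (dl L x)).sum := by
      calc σ * (R.map (dl D x)).sum - Multiset.card R = (R.map fun α => σ * dl D x α + (-1)).sum := by
            rw [Multiset.sum_map_add, Multiset.sum_map_mul_left, Multiset.map_const', Multiset.sum_replicate]; simp; ring
        _ ≤ _ := msum_le _ _ _ fun α hα => by
          refine le_trans ?_ (dl_compare D x σ μ L hD hD1 hσ hσ1 hL0 hlogL α)
          have h3 := hRδ α hα
          have h4 : dl D x α - Real.log 2 ≤ min (dl D x α) μ := le_min (by linarith) (by linarith)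
          nlinarith
    have h5 : (Multiset.card R : ℝ) ≤ m := by
      have := croots_card F
      rw [hPR, Multiset.card_add, hm] at this
      exact_mod_cast (by omega : Multiset.card R ≤ m)
    linarith
  push_cast at hlog
  have hpp : (1:ℝ) ≤ p := by exact_mod_cast hp
  have h6 := mul_le_mul_of_nonneg_left hlow (by linarith : (0:ℝ) ≤ p)
  have h7 : Real.log L = - (σ * μ) := by linarith
  rw [h7] at hlog
  nlinarith

theorem notok (K σ E x D : ℝ) (hD : 0 < D) (hD1 : D ≤ 1) (hσ : 0 < σ) (hσ1 : σ ≤ 1) (hE : 0 ≤ E)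
    (hx : x ∈ Set.Icc (-K) K) (F : Polynomial ℤ) (iF : Irreducible F) (m : ℕ) (hm : F.natDegree = m) (hm1 : 1 ≤ m)
    (hno1 : ∀ j, x ∉ OKset K σ (Real.exp (-2*E)) m 1 j) (hno2 : ∀ j, x ∉ OKset K σ (Real.exp (-2*E)) m 2 j) :
    ∃ t : ℝ, 0 ≤ t ∧ t ≤ σ * (- Real.log D) ∧ t ≤ σ * (- Real.log (VV D x F)) ∧
      σ * (- Real.log (VV D x F)) ≤ m * Real.log (mahZ F) + t / 2 + (E + m + 2) ∧
      σ * (- Real.log (VV D x F)) ≤ m * Real.log (mahZ F) / 2 + t + (E + m + 2) := by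
  have hl2 : 0 < Real.log 2 := Real.log_pos (by norm_num)
  have hl2' : Real.log 2 ≤ 1 := by have := Real.log_two_lt_d9; linarith
  have hcard := croots_card F
  have hh : 0 ≤ Real.log (mahZ F) := Real.log_nonneg (mahZ_ge F iF.ne_zero)
  have hmh : 0 ≤ m * Real.log (mahZ F) := by positivity
  have hδ0 := dl_nonneg D x hD hD1
  have hsum0 : ∀ S : Multiset ℂ, 0 ≤ (S.map (dl D x)).sum := fun S => Multiset.sum_nonneg (by
      intro a ha; obtain ⟨β, _, rfl⟩ := Multiset.mem_map.1 ha; exact hδ0 β)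
  have hmax : ∀ S : Multiset ℂ, S ≠ 0 → ∃ α S', S = α ::ₘ S' ∧ ∀ β ∈ S', dl D x β ≤ dl D x α := by
    intro S hS
    obtain ⟨a, ha⟩ := Multiset.exists_mem_of_ne_zero hS
    obtain ⟨α, hα, hmaxα⟩ := S.toFinset.exists_max_image (dl D x) ⟨a, Multiset.mem_toFinset.2 ha⟩
    obtain ⟨S', hS'⟩ := Multiset.exists_cons_of_mem (Multiset.mem_toFinset.1 hα)
    exact ⟨α, S', hS', fun β hβ => hmaxα β (Multiset.mem_toFinset.2 (hS' ▸ Multiset.mem_cons_of_mem hβ))⟩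
  have hfl : ∀ d : ℝ, 0 ≤ d → (⌊d / Real.log 2⌋₊ : ℝ) * Real.log 2 ≤ d ∧ d ≤ (⌊d / Real.log 2⌋₊ : ℝ) * Real.log 2 + Real.log 2 := by
    intro d hd
    have h1 := Nat.floor_le (by positivity : 0 ≤ d / Real.log 2)
    have h2 := (Nat.lt_floor_add_one (d / Real.log 2)).le
    rw [le_div_iff₀ hl2] at h1
    rw [div_le_iff₀ hl2] at h2
    exact ⟨h1, by linarith⟩
  obtain ⟨α1, R1, hR1, hmx1⟩ := hmax (croots F) (by rw [← Multiset.card_pos, hcard]; omega)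
  have hI : - Real.log (VV D x F) = dl D x α1 + (R1.map (dl D x)).sum := by
    rw [VV_log D x hD, hR1, Multiset.map_cons, Multiset.sum_cons]
  rw [hI]
  have hc1 : (Multiset.card R1 : ℝ) ≤ m := by
    rw [hR1, Multiset.card_cons, hm] at hcard
    exact_mod_cast (by omega : Multiset.card R1 ≤ m)
  have hsmall : ∀ S : Multiset ℂ, ∀ c, (∀ β ∈ S, dl D x β ≤ c) → (S.map (dl D x)).sum ≤ Multiset.card S * c := by
    intro S c h
    calc _ ≤ (S.map fun _ => c).sum := msum_le _ _ _ h
      _ = _ := by rw [Multiset.map_const', Multiset.sum_replicate, nsmul_eq_mul]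
  have hd1 := hδ0 α1
  have hR1s := hsum0 R1
  refine ⟨σ * dl D x α1, by positivity, ?_, ?_, ?_, ?_⟩
  · have := dl_le D x hD α1; gcongr
  · nlinarith
  · -- p = 1
    set j := ⌊dl D x α1 / Real.log 2⌋₊ with hj
    obtain ⟨hf1, hf2⟩ := hfl _ hd1
    rw [← hj] at hf1 hf2
    rcases Nat.eq_zero_or_pos j with h0 | h0
    · rw [h0] at hf2
      simp only [CharP.cast_eq_zero, zero_mul, zero_add] at hf2
      have h1 := hsmall R1 1 (fun β hβ => (hmx1 β hβ).trans (hf2.trans hl2'))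
      have h3 : 0 ≤ σ * dl D x α1 := by positivity
      have h4 : σ * (dl D x α1 + (R1.map (dl D x)).sum) ≤ 1 * (1 + m) := by
        gcongr
        · linarith
        · linarith
      linarith
    · have h1 := notok_p K σ E x D hD hD1 hσ hσ1 hx F iF m 1 j hm h0 le_rfl (hno1 j) {α1} R1
        (by rw [hR1]; rfl) (by simp) (by intro α hα; rw [Multiset.mem_singleton.1 hα]; exact hf1)
        (fun β hβ => (hmx1 β hβ).trans hf2)
      push_cast at h1
      have h5 : σ * dl D x α1 ≤ σ * (j * Real.log 2) + 1 := by nlinarith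
      nlinarith
  · rcases eq_or_ne R1 0 with hz | hz
    · rw [hz]; simp; linarith [(by positivity : (0:ℝ) ≤ m)]
    obtain ⟨α2, R2, hR2, hmx2⟩ := hmax R1 hz
    have hd2 := hδ0 α2
    have h21 : dl D x α2 ≤ dl D x α1 := hmx1 α2 (by rw [hR2]; exact Multiset.mem_cons_self _ _)
    have hI2 : (R1.map (dl D x)).sum = dl D x α2 + (R2.map (dl D x)).sum := by
      rw [hR2, Multiset.map_cons, Multiset.sum_cons]
    set j := ⌊dl D x α2 / Real.log 2⌋₊ with hj
    obtain ⟨hf1, hf2⟩ := hfl _ hd2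
    rw [← hj] at hf1 hf2
    rcases Nat.eq_zero_or_pos j with h0 | h0
    · rw [h0] at hf2
      simp only [CharP.cast_eq_zero, zero_mul, zero_add] at hf2
      have h1 := hsmall R1 1 (fun β hβ => by
        rw [hR2] at hβ
        rcases Multiset.mem_cons.1 hβ with h | h
        · rw [h]; linarith
        · exact (hmx2 β h).trans (hf2.trans hl2'))
      have h4 : σ * (R1.map (dl D x)).sum ≤ 1 * m := by gcongr; linarith
      linarith
    · have h1 := notok_p K σ E x D hD hD1 hσ hσ1 hx F iF m 2 j hm h0 (by norm_num) (hno2 j) {α1, α2} R2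
        (by rw [hR1, hR2]; simp [Multiset.insert_eq_cons, Multiset.cons_add]) (by simp) (by
          intro α hα
          simp only [Multiset.insert_eq_cons, Multiset.mem_cons, Multiset.mem_singleton] at hα
          rcases hα with h | h
          · rw [h]; linarith
          · rw [h]; exact hf1)
        (fun β hβ => (hmx2 β hβ).trans hf2)
      push_cast at h1
      rw [hI2]
      have h5 : σ * dl D x α2 ≤ σ * (j * Real.log 2) + 1 := by nlinarith
      nlinarith

open MeasureTheory
open scoped ENNReal

theorem comb {ι : Type*} (S : Multiset ι) (J h : ι → ℝ) (m : ι → ℕ) (n : ℕ) (hn : 2 ≤ n) (N Z e : ℝ) (he : 0 ≤ e)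
    (hh : ∀ f ∈ S, 0 ≤ h f) (h0 : ∀ f ∈ S, m f = 0 → J f ≤ 0)
    (h1 : ∀ f ∈ S, 1 ≤ m f → ∃ t, 0 ≤ t ∧ t ≤ N / 2 ∧ t ≤ J f ∧ J f ≤ m f * h f + t / 2 + e ∧
      J f ≤ m f * h f / 2 + t + e)
    (hm : (S.map m).sum ≤ n) (hZ : (S.map h).sum ≤ Z) (hN : N ≤ (S.map J).sum + (Z - (S.map h).sum)) :
    N ≤ n * Z + (4 * n + 2) * e := by
  have hn' : (2:ℝ) ≤ n := by exact_mod_cast hn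
  have hJ : ∀ f ∈ S, J f ≤ 2 * m f * h f + 2 * e * m f := by
    intro f hf
    rcases Nat.eq_zero_or_pos (m f) with hz | hp
    · have := h0 f hf hz
      simp [hz]; exact this
    · obtain ⟨t, a1, a2, a3, a4, a5⟩ := h1 f hf hp
      have : (1:ℝ) ≤ m f := by exact_mod_cast hp
      nlinarith
  have hen : 0 ≤ e * n := by positivity
  have hsumJ : ∀ (S' : Multiset ι) (k : ℝ), (∀ f ∈ S', f ∈ S) → (∀ f ∈ S', 2 * (m f : ℝ) ≤ k) →
      (S'.map J).sum ≤ k * (S'.map h).sum + 2 * e * ((S'.map m).sum : ℕ) := by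
    intro S' k hs hk
    calc (S'.map J).sum ≤ (S'.map (fun f => k * h f + 2 * e * (m f : ℝ))).sum := by
          apply Multiset.sum_map_le_sum_map
          intro f hf
          refine (hJ f (hs f hf)).trans ?_
          have := mul_le_mul_of_nonneg_right (hk f hf) (hh f (hs f hf))
          linarith
      _ = _ := by
          rw [Multiset.sum_map_add, Multiset.sum_map_mul_left, Multiset.sum_map_mul_left]
          congr 2
          rw [Nat.cast_multiset_sum, Multiset.map_map]; rfl
  have hH0 : 0 ≤ (S.map h).sum := Multiset.sum_nonneg (by
    intro a ha; obtain ⟨f, hf, rfl⟩ := Multiset.mem_map.1 ha; exact hh f hf)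
  by_cases hall : ∀ f ∈ S, 2 * m f ≤ n
  · have h2 := hsumJ S n (fun f hf => hf) (fun f hf => by exact_mod_cast hall f hf)
    have h3 : (((S.map m).sum : ℕ) : ℝ) ≤ n := by exact_mod_cast hm
    have h4 : 2 * e * (((S.map m).sum : ℕ) : ℝ) ≤ 2 * e * n := by gcongr
    nlinarith
  · push Not at hall
    obtain ⟨f, hf, hfm⟩ := hall
    obtain ⟨R, hR⟩ := Multiset.exists_cons_of_mem hf
    have hmem : ∀ g ∈ R, g ∈ S := fun g hg => by rw [hR]; exact Multiset.mem_cons_of_mem hg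
    rw [hR] at hm hZ hN hH0
    simp only [Multiset.map_cons, Multiset.sum_cons] at hm hZ hN hH0
    have hmle : m f ≤ n := by omega
    have hmf : (m f : ℝ) ≤ n := by exact_mod_cast hmle
    have hfm' : (n:ℝ) < 2 * m f := by exact_mod_cast hfm
    have h2 := hsumJ R (2 * (n - m f)) hmem (fun g hg => by
      have : m g ≤ (R.map m).sum := Multiset.single_le_sum (fun _ _ => Nat.zero_le _) _ (Multiset.mem_map_of_mem m hg)
      have : m g + m f ≤ n := by omega
      have : (m g : ℝ) + m f ≤ n := by exact_mod_cast this
      linarith)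
    have h3 : (((R.map m).sum : ℕ) : ℝ) ≤ n := by
      have : (R.map m).sum ≤ n := by omega
      exact_mod_cast this
    have h4 : 2 * e * (((R.map m).sum : ℕ) : ℝ) ≤ 2 * e * n := by gcongr
    have hH1 : 0 ≤ (R.map h).sum := Multiset.sum_nonneg (by
      intro a ha; obtain ⟨f, hf, rfl⟩ := Multiset.mem_map.1 ha; exact hh f (hmem f hf))
    have hhf := hh f hf
    have hJf := hJ f hf
    obtain ⟨t, a1, a2, a3, a4, a5⟩ := h1 f hf (by omega)
    set M : ℝ := (m f : ℝ)
    set H' := (R.map h).sum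
    set x := h f
    have hem : e * M ≤ e * n := by gcongr
    rcases eq_or_lt_of_le hmle with heq | hlt
    · have hM : M = n := by show ((m f : ℕ) : ℝ) = n; rw [heq]
      have e1 : (R.map J).sum ≤ 2 * e * n := by
        have : 2 * ((n:ℝ) - M) * H' = 0 := by rw [hM]; ring
        linarith
      rw [hM] at a5
      have e2 : N / 2 ≤ n * x / 2 + (Z - x) + 2 * e * n + e := by linarith
      have e3 : (n:ℝ) * x / 2 + (Z - x) ≤ n / 2 * Z := by
        nlinarith [mul_nonneg (by linarith : (0:ℝ) ≤ n / 2 - 1) (by linarith : 0 ≤ Z - x)]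
      linarith
    · have hM : M + 1 ≤ n := by
        have : m f + 1 ≤ n := hlt
        show ((m f : ℕ) : ℝ) + 1 ≤ n
        exact_mod_cast this
      have hN' : N ≤ J f + 2 * (n - M) * (Z - x) + 2 * e * n := by nlinarith
      by_cases hx : x ≤ Z / 2
      · nlinarith [mul_nonneg (by linarith : 0 ≤ 2 * M - n) (by linarith : 0 ≤ Z / 2 - x)]
      · have hx1 : 0 ≤ x - Z/2 := by linarith
        have hx2 : 0 ≤ Z - x := by linarith
        by_cases hM3 : 2 * n ≤ 3 * M
        · have : N / 2 ≤ M * x / 2 + 2 * (n - M) * (Z - x) + 2 * e * n + e := by linarith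
          have key : M * x / 2 + 2 * (n - M) * (Z - x) ≤ n / 2 * Z := by
            nlinarith [mul_nonneg hx1 (by linarith : 0 ≤ n - M), mul_nonneg hx2 (by linarith : 0 ≤ 3 * M - 2 * n)]
          linarith
        · have : 3 * N / 4 ≤ M * x + 2 * (n - M) * (Z - x) + 2 * e * n + e := by linarith
          have key : M * x + 2 * (n - M) * (Z - x) ≤ 3 * n / 4 * Z := by
            nlinarith [mul_nonneg hx1 (by linarith : 0 ≤ 3 * n / 4 - M), mul_nonneg hx2 (by linarith : 0 ≤ 2 * M - n)]
          linarith

theorem croots_mul (F G : Polynomial ℤ) (hF : F ≠ 0) (hG : G ≠ 0) : croots (F * G) = croots F + croots G := by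
  unfold croots
  rw [Polynomial.map_mul, Polynomial.roots_mul]
  rw [← Polynomial.map_mul]
  exact (Polynomial.map_ne_zero_iff (Int.castRingHom ℂ).injective_int).2 (mul_ne_zero hF hG)

theorem mahZ_mul (F G : Polynomial ℤ) : mahZ (F * G) = mahZ F * mahZ G := by
  unfold mahZ
  rw [Polynomial.map_mul, Polynomial.mahlerMeasure_mul]

theorem VV_mul (L x : ℝ) (F G : Polynomial ℤ) (hF : F ≠ 0) (hG : G ≠ 0) : VV L x (F * G) = VV L x F * VV L x G := by
  unfold VV
  rw [croots_mul F G hF hG, Multiset.map_add, Multiset.prod_add]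

theorem VV_const (L x : ℝ) (F : Polynomial ℤ) (h : F.natDegree = 0) : VV L x F = 1 := by
  unfold VV
  have := croots_card F
  rw [h, Multiset.card_eq_zero] at this
  rw [this]; simp

/-- additive data of a factorization -/
theorem prod_data (L x : ℝ) (hL : 0 < L) (S : Multiset (Polynomial ℤ)) (hS : ∀ f ∈ S, f ≠ 0) :
    Real.log (mahZ S.prod) = (S.map fun f => Real.log (mahZ f)).sum ∧
    Real.log (VV L x S.prod) = (S.map fun f => Real.log (VV L x f)).sum ∧
    S.prod.natDegree = (S.map fun f => f.natDegree).sum := by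
  induction S using Multiset.induction_on with
  | empty =>
    refine ⟨?_, ?_, ?_⟩
    · simp [mahZ]
    · simp [VV, croots]
    · simp
  | cons f S ih =>
    have hf : f ≠ 0 := hS f (Multiset.mem_cons_self _ _)
    have hS' : ∀ g ∈ S, g ≠ 0 := fun g hg => hS g (Multiset.mem_cons_of_mem hg)
    have hP : S.prod ≠ 0 := Multiset.prod_ne_zero (fun h => hS' 0 h rfl)
    obtain ⟨i1, i2, i3⟩ := ih hS'
    simp only [Multiset.prod_cons, Multiset.map_cons, Multiset.sum_cons]
    refine ⟨?_, ?_, ?_⟩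
    · rw [mahZ_mul, Real.log_mul, i1]
      · exact (lt_of_lt_of_le one_pos (mahZ_ge f hf)).ne'
      · exact (lt_of_lt_of_le one_pos (mahZ_ge _ hP)).ne'
    · rw [VV_mul _ _ _ _ hf hP, Real.log_mul (VV_pos L x hL f).ne' (VV_pos L x hL _).ne', i2]
    · rw [Polynomial.natDegree_mul hf hP, i3]

theorem factor_data (L x : ℝ) (hL : 0 < L) (F : Polynomial ℤ) (hF : F ≠ 0) :
    ∃ S : Multiset (Polynomial ℤ), (∀ f ∈ S, Irreducible f) ∧
    Real.log (mahZ F) = (S.map fun f => Real.log (mahZ f)).sum ∧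
    Real.log (VV L x F) = (S.map fun f => Real.log (VV L x f)).sum ∧
    F.natDegree = (S.map fun f => f.natDegree).sum := by
  classical
  obtain ⟨S, hS, u, hu⟩ := WfDvdMonoid.exists_factors F hF
  refine ⟨S, hS, ?_⟩
  obtain ⟨i1, i2, i3⟩ := prod_data L x hL S (fun f hf => (hS f hf).ne_zero)
  have hP : S.prod ≠ 0 := Multiset.prod_ne_zero (fun h => (hS 0 h).ne_zero rfl)
  have hu0 : (u : Polynomial ℤ).natDegree = 0 := Polynomial.natDegree_coe_units u
  have hune : (u : Polynomial ℤ) ≠ 0 := u.ne_zero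
  have hmu : mahZ (u : Polynomial ℤ) = 1 := by
    have h1 := mahZ_ge _ hune
    have h2 := mahZ_ge _ (u⁻¹).ne_zero
    have h3 : mahZ (u : Polynomial ℤ) * mahZ ((u⁻¹ : (Polynomial ℤ)ˣ) : Polynomial ℤ) = 1 := by
      rw [← mahZ_mul, Units.mul_inv]; simp [mahZ]
    nlinarith
  refine ⟨?_, ?_, ?_⟩
  · rw [← hu, mahZ_mul, hmu, mul_one, i1]
  · rw [← hu, VV_mul _ _ _ _ hP hune, VV_const _ _ _ hu0, mul_one, i2]
  · rw [← hu, Polynomial.natDegree_mul hP hune, hu0, add_zero, i3]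

/-- a bad point lies in an exceptional set -/
theorem bad_in_OK (n : ℕ) (hn : 2 ≤ n) (K : ℝ) (hK : 0 ≤ K) : ∃ C : ℝ, 1 ≤ C ∧
    ∀ (σ E lam x l : ℝ), 0 < σ → σ ≤ 1 → 0 ≤ E → 0 ≤ l → 0 < lam → x ∈ Set.Icc (-K) K →
    BadPt n (Real.exp l) (Real.exp (-((1 + lam)/2 * l))) x →
    n * (lam * l + C) + (4 * n + 2) * (E + n + 2) < σ * (1 + lam) * l →
    ∃ m p j : ℕ, 1 ≤ m ∧ m ≤ n ∧ 1 ≤ p ∧ p ≤ 2 ∧ x ∈ OKset K σ (Real.exp (-2*E)) m p j := by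
  obtain ⟨C, hC, hbad⟩ := bad_small n K hK
  refine ⟨C, hC, ?_⟩
  intro σ E lam x l hσ hσ1 hE hl hlam hx hB hlt
  by_contra hcon
  push Not at hcon
  set D := Real.exp (-((1 + lam)/2 * l)) with hDdef
  have hD : 0 < D := Real.exp_pos _
  have hD1 : D ≤ 1 := by
    rw [hDdef, Real.exp_le_one_iff]
    have : 0 ≤ (1 + lam)/2 * l := by positivity
    linarith
  have hlogD : Real.log D = -((1 + lam)/2 * l) := Real.log_exp _
  obtain ⟨F, hF0, hFd, hF1, hF2⟩ := hbad (Real.exp l) D x (Real.exp_pos _) hD hD1 (abs_le.2 hx) hB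
  obtain ⟨S, hS, i1, i2, i3⟩ := factor_data D x hD F hF0
  have hlC : Real.log C ≤ C := (Real.log_le_sub_one_of_pos (by linarith)).trans (by linarith)
  have hM := mahZ_ge F hF0
  have hM0 : 0 < mahZ F := by linarith
  have b1 : Real.log (mahZ F) + Real.log (VV D x F) ≤ C - l := by
    have := Real.log_le_log (mul_pos hM0 (VV_pos D x hD F)) hF1
    rw [Real.log_mul hM0.ne' (VV_pos D x hD F).ne', Real.log_div (by linarith) (Real.exp_pos _).ne', Real.log_exp] at this
    linarith
  have b2 : Real.log (mahZ F) ≤ lam * l + C := by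
    have := Real.log_le_log hM0 hF2
    rw [Real.log_div (by linarith) (by positivity), Real.log_mul (Real.exp_pos _).ne' (by positivity), Real.log_exp,
      Real.log_pow, hlogD] at this
    push_cast at this
    linarith
  have hsumJ : (S.map fun f => σ * (- Real.log (VV D x f))).sum = σ * (- Real.log (VV D x F)) := by
    rw [Multiset.sum_map_mul_left, i2]
    simp
  have := comb S (fun f => σ * (- Real.log (VV D x f))) (fun f => Real.log (mahZ f)) (fun f => f.natDegree) n hn
    (σ * (1 + lam) * l) (lam * l + C) (E + n + 2) (by positivity)
    (fun f hf => Real.log_nonneg (mahZ_ge f (hS f hf).ne_zero))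
    (fun f hf h0 => by simp [VV_const D x f h0])
    (fun f hf h1 => by
      have hfn : f.natDegree ≤ n := by
        refine le_trans ?_ hFd
        rw [i3]
        exact Multiset.single_le_sum (fun _ _ => Nat.zero_le _) _ (Multiset.mem_map_of_mem (fun f : Polynomial ℤ => f.natDegree) hf)
      obtain ⟨t, a1, a2, a3, a4, a5⟩ := notok K σ E x D hD hD1 hσ hσ1 hE hx f (hS f hf) f.natDegree rfl h1
        (fun j => hcon _ 1 j h1 hfn le_rfl (by norm_num)) (fun j => hcon _ 2 j h1 hfn (by norm_num) le_rfl)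
      have hfn' : (f.natDegree : ℝ) ≤ n := by exact_mod_cast hfn
      rw [hlogD] at a2
      exact ⟨t, a1, by linarith, a3, by linarith, by linarith⟩)
    (by rw [← i3]; exact hFd) (by rw [← i1]; exact b2) (by
      rw [hsumJ, ← i1]
      nlinarith [mul_nonneg (by linarith : 0 ≤ 1 - σ) (by linarith : 0 ≤ lam * l + C - Real.log (mahZ F)),
        mul_le_mul_of_nonneg_left b1 hσ.le])
  linarith

open MeasureTheory
open scoped ENNReal

theorem half_pow_exp (j : ℕ) : (1/2:ℝ)^j = Real.exp (-(j * Real.log 2)) := by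
  rw [one_div, inv_pow, Real.exp_neg, mul_comm, Real.exp_mul, Real.exp_log (by norm_num), Real.rpow_natCast]

theorem bad_content (n : ℕ) (hn : 1 ≤ n) (K σ s : ℝ) (hK : 0 < K) (hσ : 0 < σ) (hσ1 : σ ≤ 1) (hσs : σ < s) :
    ∃ C : ℝ, 0 ≤ C ∧ ∀ E : ℝ, 3^(n*n) * Real.exp (-2*E) < 1 →
      hcont s {x | ∃ m p j : ℕ, 1 ≤ m ∧ m ≤ n ∧ 1 ≤ p ∧ p ≤ 2 ∧ x ∈ OKset K σ (Real.exp (-2*E)) m p j} ≤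
        ENNReal.ofReal (C * Real.exp (-((s-σ)/(4*n*σ) * E))) := by
  have hl2 : 0 < Real.log 2 := Real.log_pos (by norm_num)
  have hs : 0 < s := by linarith
  have hn0 : (0:ℝ) < n := by exact_mod_cast hn
  set r := Real.exp (-((s-σ)/2 * Real.log 2)) with hr
  have hr0 : 0 < r := Real.exp_pos _
  have hr1 : r < 1 := by
    rw [hr, Real.exp_lt_one_iff]
    have : 0 < (s-σ)/2 * Real.log 2 := mul_pos (by linarith) hl2
    linarith
  set B : ℝ := (2*K+1) * n * 2^s with hB
  have hB0 : 0 ≤ B := by positivity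
  refine ⟨(n+1) * 3 * B * (1 - r)⁻¹, by
    have : 0 < 1 - r := by linarith
    positivity, ?_⟩
  intro E hE
  set c := Real.exp (-2*E) with hc
  set w := Real.exp (-((s-σ)/(4*n*σ) * E)) with hw
  have hw0 : 0 < w := Real.exp_pos _
  have hone : ∀ m p j : ℕ, 1 ≤ m → m ≤ n → 1 ≤ p → p ≤ 2 → hcont s (OKset K σ c m p j) ≤ ENNReal.ofReal (B * w * r^j) := by
    intro m p j hm hmn hp hp2
    rcases (OKset K σ c m p j).eq_empty_or_nonempty with h0 | ⟨x, hx⟩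
    · rw [h0]; simp
    have hsc := OKset_scale K σ c hσ (Real.exp_pos _).le m p j x hx
    have hmn' : (m:ℝ) ≤ n := by exact_mod_cast hmn
    have hp2' : (p:ℝ) ≤ 2 := by exact_mod_cast hp2
    have hcm : 3 ^ (m*m) * c < 1 := by
      refine lt_of_le_of_lt ?_ hE
      gcongr
      norm_num
    refine (OKset_content K σ c s hK hσ hσ1 hs (Real.exp_pos _).le m p j hm hp hcm).trans ?_
    apply ENNReal.ofReal_le_ofReal
    have hj : E / (2 * n * σ) ≤ j * Real.log 2 := by
      rw [half_pow_exp, ← Real.exp_mul, ← Real.exp_nat_mul, hc, Real.exp_le_exp] at hsc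
      push_cast at hsc
      rw [div_le_iff₀ (by positivity)]
      have h1 : (m:ℝ) * p ≤ 2 * n := by nlinarith
      have h2 : 0 ≤ (j:ℝ) * Real.log 2 * σ := by positivity
      nlinarith [mul_le_mul_of_nonneg_right h1 h2]
    rw [half_pow_exp, Real.mul_rpow (by norm_num) (Real.exp_pos _).le, ← Real.exp_mul, ← Real.exp_mul]
    have e1 : (2*K+1) / Real.exp (-(j * Real.log 2) * σ) * (m * (2^s * Real.exp (-(j * Real.log 2) * s))) =
        (2*K+1) * m * 2^s * Real.exp (-(j * Real.log 2) * (s - σ)) := by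
      rw [mul_sub, Real.exp_sub]; ring
    rw [e1]
    have e2 : Real.exp (-(j * Real.log 2) * (s - σ)) ≤ w * r^j := by
      rw [hw, hr, ← Real.exp_nat_mul, ← Real.exp_add, Real.exp_le_exp]
      have h3 : (s-σ)/(4*n*σ) * E = (s-σ)/2 * (E / (2 * n * σ)) := by field_simp; ring
      rw [h3]
      have := mul_le_mul_of_nonneg_left hj (by linarith : 0 ≤ (s-σ)/2)
      linarith
    calc (2*K+1) * m * 2^s * Real.exp (-(j * Real.log 2) * (s - σ)) ≤ (2*K+1) * n * 2^s * (w * r^j) := by gcongr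
      _ = _ := by rw [hB]; ring
  set A : ℕ → ℕ → ℕ → Set ℝ := fun j m p => {x | 1 ≤ m ∧ m ≤ n ∧ 1 ≤ p ∧ p ≤ 2 ∧ x ∈ OKset K σ c m p j} with hA
  have hA1 : ∀ j m p, hcont s (A j m p) ≤ ENNReal.ofReal (B * w * r^j) := by
    intro j m p
    by_cases h : 1 ≤ m ∧ m ≤ n ∧ 1 ≤ p ∧ p ≤ 2
    · refine le_trans (measure_mono ?_) (hone m p j h.1 h.2.1 h.2.2.1 h.2.2.2)
      exact fun x hx => hx.2.2.2.2
    · have : A j m p = ∅ := by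
        ext x
        constructor
        · rintro ⟨a1, a2, a3, a4, _⟩; exact (h ⟨a1, a2, a3, a4⟩).elim
        · intro h; exact h.elim
      rw [this]; simp
  have hsub : {x | ∃ m p j : ℕ, 1 ≤ m ∧ m ≤ n ∧ 1 ≤ p ∧ p ≤ 2 ∧ x ∈ OKset K σ c m p j} ⊆
      ⋃ j, ⋃ m ∈ Finset.range (n+1), ⋃ p ∈ Finset.range 3, A j m p := by
    rintro x ⟨m, p, j, h1, h2, h3, h4, h5⟩
    simp only [Set.mem_iUnion, Finset.mem_range]
    exact ⟨j, m, by omega, p, by omega, h1, h2, h3, h4, h5⟩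
  refine (measure_mono hsub).trans ((measure_iUnion_le _).trans ?_)
  have hsum : Summable (fun j : ℕ => (n+1) * 3 * (B * w * r^j)) :=
    ((summable_geometric_of_lt_one hr0.le hr1).mul_left _).mul_left _
  calc ∑' j, hcont s (⋃ m ∈ Finset.range (n+1), ⋃ p ∈ Finset.range 3, A j m p) 
      ≤ ∑' j : ℕ, ENNReal.ofReal ((n+1) * 3 * (B * w * r^j)) := by
        apply ENNReal.tsum_le_tsum
        intro j
        calc _ ≤ ∑ m ∈ Finset.range (n+1), hcont s (⋃ p ∈ Finset.range 3, A j m p) := measure_biUnion_finset_le _ _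
          _ ≤ ∑ m ∈ Finset.range (n+1), ∑ p ∈ Finset.range 3, hcont s (A j m p) :=
            Finset.sum_le_sum (fun m _ => measure_biUnion_finset_le _ _)
          _ ≤ ∑ m ∈ Finset.range (n+1), ∑ p ∈ Finset.range 3, ENNReal.ofReal (B * w * r^j) :=
            Finset.sum_le_sum (fun m _ => Finset.sum_le_sum (fun p _ => hA1 j m p))
          _ = _ := by
            simp only [Finset.sum_const, Finset.card_range, nsmul_eq_mul]
            generalize B * w * r^j = y
            rw [ENNReal.ofReal_mul (p := ((n:ℝ)+1) * 3) (by positivity), ENNReal.ofReal_mul (p := (n:ℝ)+1) (by positivity),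
              ← Nat.cast_succ, ENNReal.ofReal_natCast, mul_assoc]
            norm_num
    _ = ENNReal.ofReal (∑' j : ℕ, (n+1) * 3 * (B * w * r^j)) := by
        rw [ENNReal.ofReal_tsum_of_nonneg (fun j => by positivity) hsum]
    _ = ENNReal.ofReal ((n+1) * 3 * B * (1 - r)⁻¹ * w) := by
        rw [tsum_mul_left, tsum_mul_left, tsum_geometric_of_lt_one hr0.le hr1]
        congr 1; ring

/-- points with a good approximation of height about `exp l` -/
def appr (n : ℕ) (a b lam l : ℝ) : Set ℝ :=
  {x : ℝ | x ∈ Set.Ioo a b ∧ ∃ P : Fin (n+1) → ℤ, Real.exp l ≤ P 0 ∧ (P 0 : ℝ) ≤ 2 * Real.exp l ∧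
      ∀ i : Fin (n+1), |(P 0 : ℝ) * x ^ (i:ℕ) - P i| ≤ Real.exp (-(lam * l))}

theorem appr_cover (n : ℕ) (a b lam : ℝ) (hlam : 0 < lam) (x : ℝ) (hx : x ∈ SimSet n (Set.Ioo a b) lam) :
    ∃ᶠ k : ℕ in Filter.atTop, x ∈ appr n a b lam (k * Real.log 2) := by
  obtain ⟨hxI, hx2⟩ := hx
  unfold simExponent at hx2
  obtain ⟨y, ⟨l, ⟨hl0, hinf⟩, rfl⟩, hly⟩ := lt_sSup_iff.1 hx2
  have hll : lam < l := by
    rwa [ENNReal.ofReal_lt_ofReal_iff hl0] at hly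
  rw [Filter.frequently_atTop]
  intro k0
  obtain ⟨q, ⟨hq0, hq⟩, hqk⟩ := hinf.exists_gt (2^k0)
  refine ⟨Nat.log 2 q, Nat.le_log_of_pow_le (by norm_num) hqk.le, hxI, fun i => round ((q:ℝ) * x^(i:ℕ)), ?_⟩
  have hP0 : ((round ((q:ℝ) * x^((0 : Fin (n+1)) : ℕ)) : ℤ) : ℝ) = q := by simp
  have hex : Real.exp ((Nat.log 2 q : ℕ) * Real.log 2) = (2:ℝ)^(Nat.log 2 q) := by
    rw [mul_comm, Real.exp_mul, Real.exp_log (by norm_num), Real.rpow_natCast]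
  have hle : (2:ℝ)^(Nat.log 2 q) ≤ q := by exact_mod_cast Nat.pow_log_le_self 2 hq0.ne'
  have hlt : (q:ℝ) < 2 * (2:ℝ)^(Nat.log 2 q) := by
    have := Nat.lt_pow_succ_log_self (b := 2) (by norm_num) q
    rw [pow_succ] at this
    have h : (q:ℝ) < 2^(Nat.log 2 q) * 2 := by exact_mod_cast this
    linarith
  have hq1 : (1:ℝ) ≤ q := by exact_mod_cast hq0
  simp only [hP0]
  rw [hex]
  refine ⟨hle, hlt.le, ?_⟩
  intro i
  rcases Nat.eq_zero_or_pos (i:ℕ) with hi | hi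
  · rw [hi]; simp; positivity
  · have h1 := hq i (Finset.mem_Icc.2 ⟨hi, by omega⟩)
    unfold distNearestInt at h1
    refine h1.trans ?_
    calc (q:ℝ)^(-l) ≤ (q:ℝ)^(-lam) := Real.rpow_le_rpow_of_exponent_le hq1 (by linarith)
      _ ≤ ((2:ℝ)^(Nat.log 2 q))^(-lam) := Real.rpow_le_rpow_of_nonpos (by positivity) hle (by linarith)
      _ = _ := by
        rw [← hex, ← Real.exp_mul]; congr 1; ring

theorem upper_aux (n : ℕ) (hn : 2 ≤ n) (a b lam s : ℝ) (h1 : 1 / (n : ℝ) < lam) (h2 : lam ≤ 2 / (2 * (n : ℝ) - 1))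
    (hs : (2 - ((n : ℝ) - 1) * lam) / (1 + lam) < s) (hs1 : s ≤ 1) :
    dimH (SimSet n (Set.Ioo a b) lam) ≤ ENNReal.ofReal s := by
  have hl2 : 0 < Real.log 2 := Real.log_pos (by norm_num)
  have hn2 : (2:ℝ) ≤ n := by exact_mod_cast hn
  have hlam : 0 < lam := lt_trans (by positivity) h1
  have hnl : (2 * (n:ℝ) - 1) * lam ≤ 2 := by
    rw [le_div_iff₀ (by linarith)] at h2; linarith
  set s0 := (2 - ((n : ℝ) - 1) * lam) / (1 + lam) with hs0
  have hs0' : s0 * (1 + lam) = 2 - ((n : ℝ) - 1) * lam := by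
    rw [hs0]; field_simp
  have hs0p : 0 < s0 := by
    rw [hs0]; apply div_pos _ (by linarith); nlinarith
  have hsp : 0 < s := hs0p.trans hs
  set σ := (s0 + s) / 2 with hσd
  have hσ : 0 < σ := by linarith
  have hσ1 : σ ≤ 1 := by linarith
  have hσs : σ < s := by linarith
  have hσ0 : s0 < σ := by linarith
  set K := |a| + |b| + 1 with hKd
  have hK : 0 < K := by positivity
  have hIK : ∀ x ∈ Set.Ioo a b, x ∈ Set.Icc (-K) K := by
    intro x hx
    have := neg_abs_le a
    have := le_abs_self b
    have := abs_nonneg a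
    have := abs_nonneg b
    exact ⟨by linarith [hx.1], by linarith [hx.2]⟩
  obtain ⟨C1, hC1, hgood⟩ := good_content n (by omega) K hK s hsp
  obtain ⟨C2, hC2, hbad⟩ := bad_content n (by omega) K σ s hK hσ hσ1 hσs
  obtain ⟨C3, hC3, hin⟩ := bad_in_OK n hn K hK.le
  set η := (σ - s0) * (1 + lam) with hη
  have hη0 : 0 < η := mul_pos (by linarith) (by linarith)
  set ρ := η / (2 * (4 * n + 2)) with hρ
  have hρ0 : 0 < ρ := by positivity
  have hρ' : (4 * n + 2) * ρ = η / 2 := by rw [hρ]; field_simp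
  set a1 := (1 + lam) * (s - s0) * Real.log 2 with ha1
  have ha1p : 0 < a1 := mul_pos (mul_pos (by linarith) (by linarith)) hl2
  set a2 := (s-σ)/(4*n*σ) * ρ * Real.log 2 with ha2
  have ha2p : 0 < a2 := mul_pos (mul_pos (div_pos (by linarith) (by positivity)) hρ0) hl2
  set θ := Real.exp (-(min a1 a2)) with hθ
  have hθ1 : θ < 1 := by
    rw [hθ, Real.exp_lt_one_iff]
    have : 0 < min a1 a2 := lt_min ha1p ha2p
    linarith
  have htend : Filter.Tendsto (fun k : ℕ => (k:ℝ) * Real.log 2) Filter.atTop Filter.atTop :=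
    (tendsto_natCast_atTop_atTop (R := ℝ)).atTop_mul_const hl2
  have hev1 := htend.eventually_gt_atTop ((n * C3 + (4 * n + 2) * (n + 2)) / (η / 2))
  have hev2 := htend.eventually_gt_atTop (Real.log (3^(n*n)) / (2 * ρ))
  obtain ⟨k0, hk0⟩ := Filter.eventually_atTop.1 (hev1.and hev2)
  refine dimH_le_of_hcont s hsp _ (hcont_limsup s _ (fun k => appr n a b lam (k * Real.log 2)) k0 (C1 + C2) θ
    (by linarith) (Real.exp_pos _).le hθ1 (fun x hx => appr_cover n a b lam hlam x hx) ?_)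
  intro k hk
  obtain ⟨hA, hB⟩ := hk0 k hk
  have hl0 : 0 ≤ (k:ℝ) * Real.log 2 := by positivity
  set l := (k:ℝ) * Real.log 2 with hl
  rw [div_lt_iff₀ (by positivity)] at hA
  rw [div_lt_iff₀ (by positivity)] at hB
  set Q := Real.exp l with hQ
  set D := Real.exp (-((1 + lam)/2 * l)) with hD
  have hD0 : 0 < D := Real.exp_pos _
  have hQ1 : 1 ≤ Q := Real.one_le_exp hl0
  have hD1 : D ≤ 1 := by
    rw [hD, Real.exp_le_one_iff]
    have : 0 ≤ (1 + lam)/2 * l := by positivity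
    linarith
  have hQD : Q * D^2 = Real.exp (-(lam * l)) := by
    rw [hQ, hD, ← Real.exp_nat_mul, ← Real.exp_add]; congr 1; push_cast; ring
  have hg := hgood Q D hQ1 hD0 hD1
  have hb := hbad (ρ * l) (by
    rw [← Real.exp_log (show (0:ℝ) < 3^(n*n) by positivity), ← Real.exp_add, Real.exp_lt_one_iff]
    linarith)
  have hsub : appr n a b lam l ⊆ {x : ℝ | x ∈ Set.Icc (-K) K ∧ ¬ BadPt n Q D x ∧ ∃ P : Fin (n+1) → ℤ, Q ≤ P 0 ∧ (P 0 : ℝ) ≤ 2 * Q ∧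
      ∀ i : Fin (n+1), |(P 0 : ℝ) * x ^ (i:ℕ) - P i| ≤ Q * D^2} ∪ 
      {x | ∃ m p j : ℕ, 1 ≤ m ∧ m ≤ n ∧ 1 ≤ p ∧ p ≤ 2 ∧ x ∈ OKset K σ (Real.exp (-2*(ρ*l))) m p j} := by
    rintro x ⟨hxI, hxP⟩
    by_cases hx : BadPt n Q D x
    · right
      refine hin σ (ρ * l) lam x l hσ hσ1 (by positivity) hl0 hlam (hIK x hxI) hx ?_
      have e1 : σ * (1 + lam) * l = η * l + (2 - ((n : ℝ) - 1) * lam) * l := by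
        rw [hη, ← hs0']; ring
      have e2 : (4 * n + 2) * (ρ * l) = η / 2 * l := by rw [← hρ']; ring
      rw [e1]
      nlinarith [mul_le_mul_of_nonneg_right hnl hl0]
    · left
      refine ⟨hIK x hxI, hx, ?_⟩
      rw [hQD]; exact hxP
  refine (measure_mono hsub).trans ((measure_union_le _ _).trans ((add_le_add hg hb).trans ?_))
  rw [← ENNReal.ofReal_add (by positivity) (by positivity)]
  apply ENNReal.ofReal_le_ofReal
  have hkk : (0:ℝ) ≤ k := by positivity
  have f1 : Q^(n+1) * D^(2*n-2) * (D^2)^s ≤ θ^k := by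
    rw [hQ, hD, hθ, ← Real.exp_nat_mul, ← Real.exp_nat_mul, ← Real.exp_nat_mul, ← Real.exp_nat_mul, ← Real.exp_mul,
      ← Real.exp_add, ← Real.exp_add, Real.exp_le_exp, Nat.cast_sub (by omega)]
    push_cast
    have : (k:ℝ) * min a1 a2 ≤ k * a1 := mul_le_mul_of_nonneg_left (min_le_left _ _) hkk
    have e3 : ((n:ℝ) + 1) * l + (2 * n - 2) * (-((1 + lam)/2 * l)) + 2 * (-((1 + lam)/2 * l)) * s
        = - (k * a1) := by
      have : s0 * (1 + lam) * l = (2 - ((n : ℝ) - 1) * lam) * l := by rw [hs0']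
      rw [ha1]
      have e4 : (k:ℝ) * ((1 + lam) * (s - s0) * Real.log 2) = (1 + lam) * (s - s0) * l := by rw [hl]; ring
      rw [e4]
      linarith
    linarith
  have f2 : Real.exp (-((s-σ)/(4*n*σ) * (ρ * l))) ≤ θ^k := by
    rw [hθ, ← Real.exp_nat_mul, Real.exp_le_exp]
    have : (k:ℝ) * min a1 a2 ≤ k * a2 := mul_le_mul_of_nonneg_left (min_le_right _ _) hkk
    have e4 : (k:ℝ) * a2 = (s-σ)/(4*n*σ) * (ρ * l) := by rw [hl, ha2]; ring
    linarith
  calc _ = C1 * (Q^(n+1) * D^(2*n-2) * (D^2)^s) + C2 * Real.exp (-((s-σ)/(4*n*σ) * (ρ * l))) := by ring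
    _ ≤ C1 * θ^k + C2 * θ^k := by gcongr
    _ = _ := by ring

theorem upper_main (n : ℕ) (hn : 2 ≤ n) (a b : ℝ)
    (lam : ℝ) (h1 : 1 / (n : ℝ) ≤ lam) (h2 : lam ≤ 2 / (2 * (n : ℝ) - 1)) :
    dimH (SimSet n (Set.Ioo a b) lam) ≤ ENNReal.ofReal ((2 - ((n : ℝ) - 1) * lam) / (1 + lam)) := by
  have hn2 : (2:ℝ) ≤ n := by exact_mod_cast hn
  have hlam : 0 < lam := lt_of_lt_of_le (by positivity) h1
  have htriv : dimH (SimSet n (Set.Ioo a b) lam) ≤ ENNReal.ofReal 1 := by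
    rw [ENNReal.ofReal_one]
    refine (dimH_mono (Set.subset_univ _)).trans ?_
    rw [Real.dimH_univ]
  rcases eq_or_lt_of_le h1 with heq | hlt
  · have : (2 - ((n : ℝ) - 1) * lam) / (1 + lam) = 1 := by
      rw [← heq]; field_simp; ring
    rw [this]; exact htriv
  · have hs1 : (2 - ((n : ℝ) - 1) * lam) / (1 + lam) < 1 := by
      rw [div_lt_one (by linarith)]
      rw [div_lt_iff₀ (by linarith)] at hlt
      nlinarith
    refine ge_of_tendsto (x := nhdsWithin ((2 - ((n : ℝ) - 1) * lam) / (1 + lam)) (Set.Ioi ((2 - ((n : ℝ) - 1) * lam) / (1 + lam))))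
      (f := ENNReal.ofReal) ?_ ?_
    · exact (ENNReal.continuous_ofReal.tendsto _).mono_left nhdsWithin_le_nhds
    · filter_upwards [Ioo_mem_nhdsGT hs1] with s hs
      exact upper_aux n hn a b lam s hlt h2 hs.1 hs.2.le

/-- For `n ≥ 2`, a nonempty open interval `I` and `1/n ≤ λ ≤ 2/(2n-1)`,
`dim S_n(I, λ) = (2 - (n-1)λ)/(1+λ)`. -/
theorem stmt2 (n : ℕ) (hn : 2 ≤ n) (a b : ℝ) (hab : a < b)
    (lam : ℝ) (h1 : 1 / (n : ℝ) ≤ lam) (h2 : lam ≤ 2 / (2 * (n : ℝ) - 1)) :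
    dimH (SimSet n (Set.Ioo a b) lam) =
      ENNReal.ofReal ((2 - ((n : ℝ) - 1) * lam) / (1 + lam)) := by
  exact le_antisymm (upper_main n hn a b lam h1 h2) (lower_main n hn a b hab lam h1 h2)
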